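/- arXiv:1306.0747 — 3 statements merged into one kernel-verified Lean document; each statement's English description precedes it below -/
import Mathlib

section
/- Let G be a finite group and π a set of primes such that d_π(G) > 5/8. Then G contains an abelian Hall π-subgroup. -/
open scoped Classical Pointwise

/-- A `π`-element: every prime divisor of its order lies in `π`. -/
def IsPiElement {G : Type*} [Group G] (π : Set ℕ) (x : G) : Prop :=
  ∀ q : ℕ, q.Prime → q ∣ orderOf x → q ∈ π

/-- `kPi π G` is the number of conjugacy classes of `π`-elements of `G`. -/
noncomputable def kPi (π : Set ℕ) (G : Type*) [Group G] : ℕ :=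
  Nat.card {c : ConjClasses G | ∃ x : G, ConjClasses.mk x = c ∧ IsPiElement π x}

/-- The `π`-part of a natural number: the largest divisor all of whose prime
divisors lie in `π`. -/
noncomputable def piPart (π : Set ℕ) (n : ℕ) : ℕ :=
  n.factorization.prod fun p k => if p ∈ π then p ^ k else 1

/-- `dPi π G = kPi π G / |G|_π`. -/
noncomputable def dPi (π : Set ℕ) (G : Type*) [Group G] : ℚ :=
  (kPi π G : ℚ) / (piPart π (Nat.card G) : ℚ)

section aux

open Subgroup

theorem piAux_pow_of {G : Type*} [Group G] {t : Set ℕ} {x : G} {m : ℕ}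
    (hx : x ^ m = 1) (hm : ∀ q : ℕ, q.Prime → q ∣ m → q ∈ t) : IsPiElement t x := by
  intro q hq hd
  exact hm q hq (hd.trans (orderOf_dvd_of_pow_eq_one hx))

theorem piAux_split {n : ℕ} (hn : n ≠ 0) (t : Set ℕ) :
    ∃ a b : ℕ, a * b = n ∧ a.Coprime b ∧ (∀ q : ℕ, q.Prime → q ∣ a → q ∈ t) ∧
      (∀ q : ℕ, q.Prime → q ∣ b → q ∉ t) := by
  have key : ∀ (s : Finset ℕ), (∀ p ∈ s, p.Prime) → ∀ q : ℕ, q.Prime →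
      q ∣ ∏ p ∈ s, p ^ n.factorization p → q ∈ s := by
    intro s hs q hq hd
    obtain ⟨p, hp, hqp⟩ := (Prime.dvd_finsetProd_iff hq.prime _).1 hd
    have := hq.dvd_of_dvd_pow hqp
    rw [(Nat.prime_dvd_prime_iff_eq hq (hs p hp)).1 this]
    exact hp
  have h1 : ∀ q : ℕ, q.Prime → q ∣ ∏ p ∈ n.primeFactors with p ∈ t, p ^ n.factorization p →
      q ∈ t := by
    intro q hq hd
    have := key _ (fun p hp => Nat.prime_of_mem_primeFactors (Finset.mem_filter.1 hp).1) q hq hd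
    exact (Finset.mem_filter.1 this).2
  have h2 : ∀ q : ℕ, q.Prime → q ∣ ∏ p ∈ n.primeFactors with p ∉ t, p ^ n.factorization p →
      q ∉ t := by
    intro q hq hd
    have := key _ (fun p hp => Nat.prime_of_mem_primeFactors (Finset.mem_filter.1 hp).1) q hq hd
    exact (Finset.mem_filter.1 this).2
  refine ⟨_, _, ?_, ?_, h1, h2⟩
  · rw [Finset.prod_filter_mul_prod_filter_not]
    exact Nat.prod_factorization_pow_eq_self hn
  · apply Nat.Coprime.symm
    apply Nat.coprime_of_dvd
    intro k hk hka hkb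
    exact h2 k hk hka (h1 k hk hkb)

/-- Decomposition of an element in its `t`-part and its `t'`-part. -/
theorem piAux_decomp {G : Type*} [Group G] [Finite G] (t : Set ℕ) (x : G) :
    ∃ u v : ℕ, x ^ u * x ^ v = x ∧ IsPiElement t (x ^ u) ∧
      ∀ q : ℕ, q.Prime → q ∣ orderOf (x ^ v) → q ∣ orderOf x ∧ q ∉ t := by
  obtain ⟨a, b, hab, hc, ha, hb⟩ := piAux_split (orderOf_pos x).ne' t
  have hn := (orderOf_pos x).ne'
  have ha0 : a ≠ 0 := by rintro rfl; simp at hab; omega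
  have hb0 : b ≠ 0 := by rintro rfl; simp at hab; omega
  obtain ⟨u, hu1, hu2⟩ := Nat.chineseRemainder hc 1 0
  obtain ⟨v, hv1, hv2⟩ := Nat.chineseRemainder hc 0 1
  have hub : b ∣ u := (Nat.modEq_zero_iff_dvd).1 hu2
  have hva : a ∣ v := (Nat.modEq_zero_iff_dvd).1 hv1
  refine ⟨u, v, ?_, ?_, ?_⟩
  · rw [← pow_add]
    conv_rhs => rw [← pow_one x]
    rw [pow_eq_pow_iff_modEq, ← hab, ← Nat.modEq_and_modEq_iff_modEq_mul hc]
    exact ⟨by simpa using hu1.add hv1, by simpa using hu2.add hv2⟩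
  · refine piAux_pow_of ?_ ha
    rw [← pow_mul, ← orderOf_dvd_iff_pow_eq_one, ← hab, mul_comm u]
    exact mul_dvd_mul_left _ hub
  · intro q hq hd
    have : orderOf (x ^ v) ∣ b := by
      apply orderOf_dvd_of_pow_eq_one
      rw [← pow_mul, ← orderOf_dvd_iff_pow_eq_one, ← hab]
      exact mul_dvd_mul_right hva _
    exact ⟨hab ▸ (hd.trans this).trans (Dvd.intro_left a rfl), hb q hq (hd.trans this)⟩

theorem piAux_conj {G : Type*} [Group G] {t : Set ℕ} {x : G} (hx : IsPiElement t x) (g : G) :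
    IsPiElement t (g * x * g⁻¹) := by
  have : orderOf (g * x * g⁻¹) = orderOf x := by
    have := orderOf_injective (MulAut.conj g).toMonoidHom (MulAut.conj g).injective x
    simpa using this
  intro q hq hd
  exact hx q hq (this ▸ hd)

theorem kPi_eq_ncard (π : Set ℕ) (G : Type*) [Group G] :
    kPi π G = Set.ncard {c : ConjClasses G | ∃ x : G, ConjClasses.mk x = c ∧ IsPiElement π x} :=
  Nat.card_coe_set_eq _

theorem kPi_le_sum {G : Type*} [Group G] [Finite G] (t s : Set ℕ) (π : Set ℕ) (hπ : π ⊆ t ∪ s)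
    (R : Finset G)
    (hR : ∀ x : G, IsPiElement t x → ∃ r ∈ R, ∃ g : G, g * x * g⁻¹ = r) :
    kPi π G ≤ ∑ r ∈ R, kPi s (centralizer ({r} : Set G)) := by
  rw [kPi_eq_ncard]
  have hsub : {c : ConjClasses G | ∃ x : G, ConjClasses.mk x = c ∧ IsPiElement π x} ⊆
      ⋃ r ∈ R, (fun c : ConjClasses (centralizer ({r} : Set G)) =>
        ConjClasses.mk (r * (Quotient.out c : centralizer ({r} : Set G)).1)) ''
        {c | ∃ x : centralizer ({r} : Set G), ConjClasses.mk x = c ∧ IsPiElement s x} := by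
    rintro c ⟨x, rfl, hx⟩
    obtain ⟨u, v, huv, hu, hv⟩ := piAux_decomp t x
    obtain ⟨r, hrR, g, hg⟩ := hR _ hu
    simp only [Set.mem_iUnion]
    refine ⟨r, hrR, ?_⟩
    have hbm : g * x ^ v * g⁻¹ ∈ centralizer ({r} : Set G) := by
      rw [mem_centralizer_singleton_iff, ← hg]
      have : x ^ u * x ^ v = x ^ v * x ^ u := by rw [← pow_add, ← pow_add, add_comm]
      calc _ = g * (x ^ u * x ^ v) * g⁻¹ := by rw [this]; group
        _ = _ := by rw [this]; group
    set b : centralizer ({r} : Set G) := ⟨_, hbm⟩ with hb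
    refine ⟨ConjClasses.mk b, ⟨b, rfl, ?_⟩, ?_⟩
    · intro q hq hd
      have h1 : orderOf b = orderOf (x ^ v) := by
        rw [← Subgroup.orderOf_coe]
        have := orderOf_injective (MulAut.conj g).toMonoidHom (MulAut.conj g).injective (x ^ v)
        simpa [hb] using this
      rw [h1] at hd
      obtain ⟨h2, h3⟩ := hv q hq hd
      exact (hπ (hx q hq h2)).resolve_left h3
    · have hout : IsConj (Quotient.out (ConjClasses.mk b)) b :=
        ConjClasses.mk_eq_mk_iff_isConj.1 (Quotient.out_eq (ConjClasses.mk b))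
      obtain ⟨k, hk⟩ := isConj_iff.1 hout
      have hkr : (k : G) * r = r * k := (mem_centralizer_singleton_iff.1 k.2)
      have hk' : (k : G) * (Quotient.out (ConjClasses.mk b)).1 * (k : G)⁻¹ = g * x ^ v * g⁻¹ := by
        have := congrArg Subtype.val hk
        simpa [hb] using this
      simp only
      rw [ConjClasses.mk_eq_mk_iff_isConj]
      apply (isConj_iff.2 ⟨g⁻¹ * k, _⟩)
      calc _ = g⁻¹ * ((k * r) * (k : G)⁻¹ * (k * (Quotient.out (ConjClasses.mk b)).1 * (k : G)⁻¹)) * g := by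
              group
        _ = x ^ u * x ^ v := by rw [hkr, hk', mul_inv_cancel_right]; nth_rewrite 1 [← hg]; group
        _ = x := huv
  refine (Set.ncard_le_ncard hsub (Set.toFinite _)).trans ?_
  refine (Finset.set_ncard_biUnion_le R _).trans ?_
  apply Finset.sum_le_sum
  intro r _
  rw [kPi_eq_ncard]
  exact Set.ncard_image_le (Set.toFinite _)

theorem piAux_isPGroup {G : Type*} [Group G] [Finite G] {p : ℕ} (hp : p.Prime) {x : G}
    (hx : IsPiElement {p} x) : IsPGroup p (zpowers x) := by
  have : Fact p.Prime := ⟨hp⟩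
  rw [IsPGroup.iff_card, Nat.card_zpowers]
  refine ⟨_, Nat.eq_prime_pow_of_unique_prime_dvd (orderOf_pos x).ne' ?_⟩
  intro d hd hdx
  exact hx d hd hdx

theorem sylow_conj {G : Type*} [Group G] [Finite G] {p : ℕ} (hp : p.Prime) (P : Sylow p G) (x : G)
    (hx : IsPiElement {p} x) : ∃ g : G, g * x * g⁻¹ ∈ (P : Subgroup G) := by
  have : Fact p.Prime := ⟨hp⟩
  obtain ⟨Q, hQ⟩ := (piAux_isPGroup hp hx).exists_le_sylow
  obtain ⟨g, rfl⟩ := MulAction.exists_smul_eq G Q P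
  refine ⟨g, ?_⟩
  rw [Sylow.coe_subgroup_smul, ← MulAut.conj_apply]
  exact Subgroup.smul_mem_pointwise_smul _ (MulAut.conj g) _ (hQ (mem_zpowers x))

noncomputable def ppart (s : Finset ℕ) (n : ℕ) : ℕ := ∏ p ∈ s, p ^ n.factorization p

theorem kPi_le_ppart (s : Finset ℕ) (hs : ∀ p ∈ s, p.Prime) : ∀ (G : Type*) [Group G] [Finite G],
    kPi (s : Set ℕ) G ≤ ppart s (Nat.card G) := by
  induction s using Finset.induction_on with
  | empty =>
    intro G _ _
    rw [kPi_eq_ncard]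
    simp only [ppart, Finset.prod_empty]
    rw [Set.ncard_le_one_iff]
    have : ∀ x : G, IsPiElement ((∅ : Finset ℕ) : Set ℕ) x → x = 1 := by
      intro x hx
      rw [← orderOf_eq_one_iff]
      by_contra hne
      obtain ⟨q, hq, hd⟩ := Nat.exists_prime_and_dvd hne
      simpa using hx q hq hd
    rintro a b ⟨x, rfl, hx⟩ ⟨y, rfl, hy⟩
    rw [this x hx, this y hy]
  | insert p s hps ih =>
    intro G _ _
    have ih := ih (fun q hq => hs q (Finset.mem_insert_of_mem hq))
    have hp : p.Prime := hs p (Finset.mem_insert_self _ _)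
    have : Fact p.Prime := ⟨hp⟩
    have : Fintype G := Fintype.ofFinite G
    obtain ⟨P⟩ : Nonempty (Sylow p G) := inferInstance
    have h1 := kPi_le_sum {p} (s : Set ℕ) ((insert p s : Finset ℕ) : Set ℕ)
      (by simp) (Finset.univ.filter (· ∈ (P : Subgroup G))) (fun x hx => by
        obtain ⟨g, hg⟩ := sylow_conj hp P x hx
        exact ⟨_, by simpa using hg, g, rfl⟩)
    refine h1.trans ?_
    have h2 : ∀ r ∈ Finset.univ.filter (· ∈ (P : Subgroup G)),
        kPi (s : Set ℕ) (centralizer ({r} : Set G)) ≤ ppart s (Nat.card G) := by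
      intro r _
      refine (ih _).trans ?_
      apply Finset.prod_le_prod' 
      intro q hq
      apply Nat.pow_le_pow_right (hs q (Finset.mem_insert_of_mem hq)).pos
      exact (Nat.factorization_le_iff_dvd Nat.card_pos.ne' Nat.card_pos.ne').2
        (Subgroup.card_subgroup_dvd_card _) q
    refine (Finset.sum_le_card_nsmul _ _ _ h2).trans ?_
    have h5 : ppart (insert p s) (Nat.card G) = p ^ (Nat.card G).factorization p *
        ppart s (Nat.card G) := Finset.prod_insert hps
    rw [h5, smul_eq_mul, ← Sylow.card_eq_multiplicity P]
    refine Nat.mul_le_mul_right _ ?_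
    rw [Nat.card_eq_fintype_card, Fintype.card_subtype]

theorem ppart_pos (s : Finset ℕ) (hs : ∀ p ∈ s, p.Prime) (n : ℕ) : 0 < ppart s n :=
  Finset.prod_pos fun p hp => pow_pos (hs p hp).pos _

/-- `d_π ≤ d_μ` for `μ ⊆ π`. -/
theorem kPi_mul_le (s t : Finset ℕ) (hs : ∀ p ∈ s, p.Prime) (hts : t ⊆ s)
    (G : Type*) [Group G] [Finite G] :
    kPi (s : Set ℕ) G * ppart t (Nat.card G) ≤ kPi (t : Set ℕ) G * ppart s (Nat.card G) := by
  have : Fintype (ConjClasses G) := Fintype.ofFinite _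
  classical
  have h1 := kPi_le_sum (t : Set ℕ) ((s \ t : Finset ℕ) : Set ℕ) (s : Set ℕ) (by simp)
    (R := (Finset.univ.filter (fun c : ConjClasses G =>
      ∃ x : G, ConjClasses.mk x = c ∧ IsPiElement (t : Set ℕ) x)).image
        (fun c : ConjClasses G => (Quotient.out c : G))) (by
      intro x hx
      refine ⟨Quotient.out (ConjClasses.mk x), Finset.mem_image_of_mem _ ?_, ?_⟩
      · exact Finset.mem_filter.2 ⟨Finset.mem_univ _, x, rfl, hx⟩
      · have hout : IsConj (Quotient.out (ConjClasses.mk x)) x :=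
          ConjClasses.mk_eq_mk_iff_isConj.1 (Quotient.out_eq (ConjClasses.mk x))
        exact isConj_iff.1 hout.symm)
  have hs' : ∀ q ∈ s \ t, q.Prime := fun q hq => hs q (Finset.mem_sdiff.1 hq).1
  have h3 : kPi (s : Set ℕ) G ≤ kPi (t : Set ℕ) G * ppart (s \ t) (Nat.card G) := by
    refine h1.trans ((Finset.sum_le_card_nsmul _ _ (ppart (s \ t) (Nat.card G)) ?_).trans ?_)
    · intro r _
      refine (kPi_le_ppart _ hs' _).trans ?_
      apply Finset.prod_le_prod' 
      intro q hq
      apply Nat.pow_le_pow_right (hs' q hq).pos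
      exact (Nat.factorization_le_iff_dvd Nat.card_pos.ne' Nat.card_pos.ne').2
        (Subgroup.card_subgroup_dvd_card _) q
    · rw [smul_eq_mul]
      refine Nat.mul_le_mul_right _ (Finset.card_image_le.trans ?_)
      rw [kPi_eq_ncard, Set.ncard_eq_toFinset_card']
      apply Finset.card_le_card
      intro c
      simp
  have h4 : ppart s (Nat.card G) = ppart (s \ t) (Nat.card G) * ppart t (Nat.card G) :=
    (Finset.prod_sdiff hts).symm
  rw [h4, ← mul_assoc]
  exact Nat.mul_le_mul_right _ h3

/-- The subgroup of `P` fixed by the normalizer of `P`. -/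
def fixN {G : Type*} [Group G] (P : Subgroup G) : Subgroup G :=
  P ⊓ centralizer (normalizer (P : Set G) : Set G)

theorem fixN_le {G : Type*} [Group G] (P : Subgroup G) : fixN P ≤ P := inf_le_left

theorem fixN_comm {G : Type*} [Group G] {P : Subgroup G} {c n : G} (hc : c ∈ fixN P)
    (hn : n ∈ normalizer (P : Set G)) : n * c = c * n :=
  mem_centralizer_iff.1 hc.2 n hn

theorem fixN_of_conj {G : Type*} [Group G] {P : Subgroup G} {z n : G}
    (hn : n ∈ normalizer (P : Set G)) (h : n * z * n⁻¹ ∈ fixN P) : z ∈ fixN P := by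
  have h1 := fixN_comm h hn
  have h2 : n * z * n⁻¹ = z := by
    have : n * (n * z * n⁻¹) = n * z := by rw [h1]; group
    exact mul_left_cancel this
  rwa [h2] at h

theorem normalizer_conj_mem {G : Type*} [Group G] {P : Subgroup G} {z n : G}
    (hn : n ∈ normalizer (P : Set G)) (hz : z ∈ P) : n * z * n⁻¹ ∈ P :=
  (mem_normalizer_iff.1 hn z).1 hz

theorem two_mul_kPi_le {G : Type*} [Group G] [Finite G] {p : ℕ} (hp : p.Prime) (P : Sylow p G) :
    2 * kPi {p} G ≤ Nat.card (fixN (P : Subgroup G)) + Nat.card P := by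
  have : Fintype G := Fintype.ofFinite G
  set C := fixN (P : Subgroup G) with hC
  set A : Finset G := Finset.univ.filter (· ∈ C) with hA
  set B : Finset G := Finset.univ.filter (fun x => x ∈ (P : Subgroup G) ∧ x ∉ C) with hB
  have hcA : A.card = Nat.card C := by
    rw [Nat.card_eq_fintype_card, Fintype.card_subtype]
  have hcAB : A.card + B.card = Nat.card P := by
    rw [← Finset.card_union_of_disjoint]
    · have : Nat.card P = (Finset.univ.filter (· ∈ (P : Subgroup G))).card := by
        rw [Nat.card_eq_fintype_card, Fintype.card_subtype]
      rw [this]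
      congr 1
      ext x
      simp only [hA, hB, Finset.mem_union, Finset.mem_filter, Finset.mem_univ, true_and]
      constructor
      · rintro (h | h)
        · exact fixN_le _ h
        · exact h.1
      · intro h
        by_cases hx : x ∈ C
        · exact Or.inl hx
        · exact Or.inr ⟨h, hx⟩
    · rw [Finset.disjoint_left]
      intro x hx hx'
      exact (Finset.mem_filter.1 hx').2.2 (Finset.mem_filter.1 hx).2
  have h1 : kPi {p} G ≤ (A.image ConjClasses.mk ∪ B.image ConjClasses.mk).card := by
    rw [kPi_eq_ncard, ← Set.ncard_coe_finset]
    apply Set.ncard_le_ncard _ (Set.toFinite _)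
    rintro c ⟨x, rfl, hx⟩
    obtain ⟨g, hg⟩ := sylow_conj hp P x hx
    have hmk : ConjClasses.mk x = ConjClasses.mk (g * x * g⁻¹) :=
      ConjClasses.mk_eq_mk_iff_isConj.2 (isConj_iff.2 ⟨g, rfl⟩)
    rw [hmk, Finset.mem_coe, Finset.mem_union]
    by_cases hx : g * x * g⁻¹ ∈ C
    · exact Or.inl (Finset.mem_image_of_mem _ (by simpa [hA] using hx))
    · exact Or.inr (Finset.mem_image_of_mem _ (Finset.mem_filter.2 ⟨Finset.mem_univ _, hg, hx⟩))
  have h2 : 2 * (B.image ConjClasses.mk).card ≤ B.card := by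
    apply Finset.mul_card_image_le_card
    intro b hb
    obtain ⟨z, hz, rfl⟩ := Finset.mem_image.1 hb
    obtain ⟨-, hzP, hzC⟩ := Finset.mem_filter.1 hz
    have : ∃ n ∈ normalizer ((P : Subgroup G) : Set G), n * z * n⁻¹ ≠ z := by
      by_contra hcon
      push Not at hcon
      refine hzC ⟨hzP, mem_centralizer_iff.2 fun n hn => ?_⟩
      have := hcon n hn
      rwa [mul_inv_eq_iff_eq_mul] at this
    obtain ⟨n, hn, hnz⟩ := this
    have hsub : ({z, n * z * n⁻¹} : Finset G) ⊆
        B.filter (fun a => ConjClasses.mk a = ConjClasses.mk z) := by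
      intro w hw
      rw [Finset.mem_insert, Finset.mem_singleton] at hw
      rcases hw with rfl | rfl
      · exact Finset.mem_filter.2 ⟨hz, rfl⟩
      · refine Finset.mem_filter.2 ⟨Finset.mem_filter.2 ⟨Finset.mem_univ _, ?_, ?_⟩, ?_⟩
        · exact normalizer_conj_mem hn hzP
        · exact fun h => hzC (fixN_of_conj hn h)
        · exact (ConjClasses.mk_eq_mk_iff_isConj.2 (isConj_iff.2 ⟨n, rfl⟩)).symm
    calc 2 = ({z, n * z * n⁻¹} : Finset G).card := (Finset.card_pair hnz.symm).symm
      _ ≤ _ := Finset.card_le_card hsub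
  have h3 := Finset.card_union_le (A.image ConjClasses.mk) (B.image ConjClasses.mk)
  have h4 : (A.image ConjClasses.mk).card ≤ A.card := Finset.card_image_le
  omega

theorem pigeon4 {G : Type*} [Group G] [Finite G] {C P : Subgroup G} (hCP : C ≤ P)
    (hcard : Nat.card P < 4 * Nat.card C) {a b c d : G} (ha : a ∈ P) (hb : b ∈ P) (hc : c ∈ P)
    (hd : d ∈ P) : a⁻¹ * b ∈ C ∨ a⁻¹ * c ∈ C ∨ a⁻¹ * d ∈ C ∨ b⁻¹ * c ∈ C ∨ b⁻¹ * d ∈ C ∨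
      c⁻¹ * d ∈ C := by
  have h1 : Nat.card C * C.relIndex P = Nat.card P := by
    rw [mul_comm]
    have := (Subgroup.relIndex_mul_relIndex (⊥ : Subgroup G) C P bot_le hCP)
    rw [Subgroup.relIndex_bot_left, Subgroup.relIndex_bot_left] at this
    rw [mul_comm]; exact this
  have h2 : C.relIndex P < 4 := by
    by_contra hge
    push Not at hge
    have := Nat.mul_le_mul_left (Nat.card C) hge
    omega
  have : Fintype (P ⧸ C.subgroupOf P) := Fintype.ofFinite _
  have h3 : Fintype.card (P ⧸ C.subgroupOf P) < 4 := by
    rw [← Nat.card_eq_fintype_card]; exact h2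
  let f : Fin 4 → P := ![⟨a, ha⟩, ⟨b, hb⟩, ⟨c, hc⟩, ⟨d, hd⟩]
  obtain ⟨i, j, hij, hf⟩ := Fintype.exists_ne_map_eq_of_card_lt
    (fun i => (QuotientGroup.mk (f i) : P ⧸ C.subgroupOf P)) (by simpa using h3)
  wlog hlt : i < j generalizing i j
  · exact this j i hij.symm hf.symm (lt_of_le_of_ne (not_lt.1 hlt) hij.symm)
  have hf' := QuotientGroup.eq.1 hf
  rw [mem_subgroupOf] at hf'
  simp only [coe_mul, coe_inv] at hf'
  fin_cases i <;> fin_cases j <;> simp [f] at hf' hlt <;> tauto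

theorem sylow_comm {G : Type*} [Group G] [Finite G] {P : Subgroup G}
    (hcard : Nat.card P < 4 * Nat.card (fixN P)) {x y : G} (hx : x ∈ P) (hy : y ∈ P) :
    x * y = y * x := by
  have hPN : P ≤ normalizer (P : Set G) := le_normalizer
  have key : ∀ c ∈ fixN P, ∀ z ∈ P, z * c = c * z := fun c hc z hz => fixN_comm hc (hPN hz)
  rcases pigeon4 (fixN_le P) hcard (one_mem P) hx hy (mul_mem hx hy) with h | h | h | h | h | h
  · have := key _ h y hy
    simpa using this.symm
  · have := key _ h x hx
    simpa using this
  · have := key _ h x hx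
    simp only [inv_one, one_mul] at this
    exact mul_left_cancel (a := x) (by rw [this, mul_assoc])
  · have := key _ h x hx
    have h2 : x * (x⁻¹ * y) = y := by group
    rw [h2] at this
    calc x * y = x * (x⁻¹ * y * x) := by rw [← this]
      _ = y * x := by group
  · have := key _ h x hx
    have h2 : x⁻¹ * (x * y) = y := by group
    rwa [h2] at this
  · have := key _ h y hy
    have h2 : y * (y⁻¹ * (x * y)) = x * y := by group
    rw [h2] at this
    have h3 : x * y * y = y * (x * y) := by
      calc x * y * y = (y⁻¹ * (x * y) * y) * y := by rw [← this]
        _ = y⁻¹ * (x * y) * y * y := by group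
        _ = (x * y) * y := by rw [← this]
        _ = y * ((y⁻¹ * (x * y)) * y) := by group
        _ = _ := by rw [← this]
    exact mul_right_cancel (b := y) (by rw [h3, mul_assoc])

theorem conj_pow_aux {G : Type*} [Group G] {P : Subgroup G} {z n c : G}
    (hn : n ∈ normalizer (P : Set G)) (hc : c ∈ fixN P) (h : n * z * n⁻¹ = z * c) (k : ℕ) :
    n ^ k * z * (n ^ k)⁻¹ = z * c ^ k := by
  induction k with
  | zero => simp
  | succ k ih =>
    have h1 : n * c ^ k * n⁻¹ = c ^ k := by
      rw [fixN_comm (pow_mem hc k) hn]; group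
    calc n ^ (k + 1) * z * (n ^ (k + 1))⁻¹ = n * (n ^ k * z * (n ^ k)⁻¹) * n⁻¹ := by
          rw [pow_succ']; group
      _ = (n * z * n⁻¹) * (n * c ^ k * n⁻¹) := by rw [ih]; group
      _ = z * c ^ (k + 1) := by rw [h, h1, pow_succ', mul_assoc]

/-- Elements of the normalizer have a power, prime to `p`, centralizing `P`. -/
theorem sylow_exists_pow {G : Type*} [Group G] [Finite G] {p : ℕ} (hp : p.Prime) (P : Sylow p G) :
    ∃ m : ℕ, m.Coprime p ∧ ∀ n ∈ normalizer ((P : Subgroup G) : Set G), n ^ m ∈ (P : Subgroup G) := by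
  have : Fact p.Prime := ⟨hp⟩
  set L := normalizer ((P : Subgroup G) : Set G) with hL
  have hPL : (P : Subgroup G) ≤ L := le_normalizer
  refine ⟨(P : Subgroup G).relIndex L, ?_, ?_⟩
  · apply Nat.Coprime.symm
    rw [Nat.Prime.coprime_iff_not_dvd hp]
    intro h
    exact P.not_dvd_index (h.trans (Subgroup.relIndex_dvd_index_of_le hPL))
  · intro n hn
    have : ((P : Subgroup G).subgroupOf L).Normal := by
      rw [hL]; infer_instance
    have := Subgroup.pow_index_mem ((P : Subgroup G).subgroupOf L) (⟨n, hn⟩ : L)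
    exact (mem_subgroupOf.1 this)

theorem sylow_sq {G : Type*} [Group G] [Finite G] {p : ℕ} (hp : p.Prime) (P : Sylow p G)
    (hcard : Nat.card P < 4 * Nat.card (fixN (P : Subgroup G))) {n z : G}
    (hn : n ∈ normalizer ((P : Subgroup G) : Set G)) (hz : z ∈ (P : Subgroup G)) :
    n ^ 2 * z = z * n ^ 2 := by
  have : Fact p.Prime := ⟨hp⟩
  set C := fixN (P : Subgroup G) with hC
  have hconj : ∀ a, n * a * n⁻¹ ∈ C → a ∈ C := fun a ha => fixN_of_conj hn ha
  have hconj' : ∀ a, a ∈ C → n * a * n⁻¹ ∈ C := fun a ha => by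
    have : n * a * n⁻¹ = a := by rw [fixN_comm ha hn]; group
    rwa [this]
  have hw := normalizer_conj_mem hn hz
  have hw' := normalizer_conj_mem hn hw
  have hcase : z ∈ C ∨ z⁻¹ * (n * (n * z * n⁻¹) * n⁻¹) ∈ C := by
    have hzw : z⁻¹ * (n * z * n⁻¹) ∈ C → z⁻¹ * (n * (n * z * n⁻¹) * n⁻¹) ∈ C := by
      intro h
      have h2 := mul_mem h (hconj' _ h)
      convert h2 using 1
      group
    rcases pigeon4 (fixN_le _) hcard (one_mem _) hz hw hw' with h | h | h | h | h | h
    · left; simpa using h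
    · left; apply hconj; simpa using h
    · left; apply hconj; apply hconj; simpa using h
    · right; exact hzw h
    · right; exact h
    · right
      apply hzw
      apply hconj
      convert h using 1
      group
  rcases hcase with h | h
  · exact fixN_comm h (pow_mem hn 2)
  · set c := z⁻¹ * (n * (n * z * n⁻¹) * n⁻¹) with hc
    have hn2 := pow_mem hn 2
    have h1 : n ^ 2 * z * (n ^ 2)⁻¹ = z * c := by rw [hc, pow_two]; group
    obtain ⟨m, hm, hmP⟩ := sylow_exists_pow hp P
    have h2 := conj_pow_aux hn2 h h1 m
    rw [sylow_comm hcard (hmP _ hn2) hz, mul_inv_cancel_right] at h2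
    have hcm : c ^ m = 1 := by simpa using h2.symm
    have hcp : ∃ k, c ^ p ^ k = 1 := by
      obtain ⟨k, hk⟩ := P.isPGroup' ⟨c, fixN_le _ h⟩
      exact ⟨k, by simpa using congrArg Subtype.val hk⟩
    obtain ⟨k, hk⟩ := hcp
    have hc1 : c = 1 := by
      rw [← orderOf_eq_one_iff]
      exact Nat.eq_one_of_dvd_coprimes (hm.pow_right k) (orderOf_dvd_of_pow_eq_one hcm)
        (orderOf_dvd_of_pow_eq_one hk)
    rw [hc1, mul_one, mul_inv_eq_iff_eq_mul] at h1
    exact h1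

theorem mem_of_coprime_pow {G : Type*} [Group G] {K : Subgroup G} {n : G} {a b : ℕ}
    (hab : a.Coprime b) (ha : n ^ a ∈ K) (hb : n ^ b ∈ K) : n ∈ K := by
  have h := Nat.gcd_eq_gcd_ab a b
  rw [hab.gcd_eq_one] at h
  have h1 : n = (n ^ a) ^ (a.gcdA b) * (n ^ b) ^ (a.gcdB b) := by
    rw [← zpow_natCast, ← zpow_natCast, ← zpow_mul, ← zpow_mul, ← zpow_add, ← h]
    simp
  rw [h1]
  exact mul_mem (zpow_mem ha _) (zpow_mem hb _)

theorem pgroup_card_le {G : Type*} [Group G] [Finite G] {p k : ℕ} (hp : p.Prime)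
    {H K : Subgroup G} (hHK : H ≤ K) (hK : Nat.card K = p ^ k) (hne : H ≠ K) :
    p * Nat.card H ≤ Nat.card K := by
  have hd := Subgroup.card_dvd_of_le hHK
  rw [hK] at hd
  obtain ⟨i, hi, hH⟩ := (Nat.dvd_prime_pow hp).1 hd
  have hlt : i < k := by
    refine lt_of_le_of_ne hi ?_
    rintro rfl
    exact hne (Subgroup.eq_of_le_of_card_ge hHK (by rw [hK, hH]))
  rw [hH, hK, ← pow_succ']
  exact Nat.pow_le_pow_right hp.pos hlt

theorem sylow_card_lt {G : Type*} [Group G] [Finite G] {p : ℕ} (hp : p.Prime) (P : Sylow p G)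
    (h : 5 * Nat.card P < 8 * kPi {p} G) :
    Nat.card P < 4 * Nat.card (fixN (P : Subgroup G)) := by
  have := two_mul_kPi_le hp P
  omega

theorem exists_complement {G : Type*} [Group G] [Finite G] {p : ℕ} (hp : p.Prime) (hp3 : p ≠ 3)
    (h : 5 * p ^ (Nat.card G).factorization p < 8 * kPi {p} G) :
    ∃ N : Subgroup G, commutator G ≤ N ∧ N.index = p ^ (Nat.card G).factorization p := by
  have : Fact p.Prime := ⟨hp⟩
  obtain ⟨P⟩ : Nonempty (Sylow p G) := inferInstance
  have hPc := P.card_eq_multiplicity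
  rw [← hPc] at h
  have hcard := sylow_card_lt hp P h
  have hP : normalizer ((P : Subgroup G) : Set G) ≤ centralizer ((P : Subgroup G) : Set G) := by
    intro n hn
    by_cases hp2 : p = 2
    · subst hp2
      obtain ⟨m, hm, hmP⟩ := sylow_exists_pow hp P
      refine mem_of_coprime_pow hm (mem_centralizer_iff.2 fun x hx => ?_)
        (mem_centralizer_iff.2 fun x hx => ?_)
      · exact sylow_comm hcard hx (hmP n hn)
      · exact (sylow_sq hp P hcard hn hx).symm
    · have heq : fixN (P : Subgroup G) = P := by
        by_contra hne
        have h1 := pgroup_card_le hp (fixN_le _) hPc hne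
        have h4 : 4 ≤ p := by
          have := hp.two_le
          omega
        have := Nat.mul_le_mul_right (Nat.card (fixN (P : Subgroup G))) h4
        omega
      refine mem_centralizer_iff.2 fun x hx => ?_
      have hx' : x ∈ fixN (P : Subgroup G) := by rw [heq]; exact hx
      exact (fixN_comm hx' hn).symm
  refine ⟨(MonoidHom.transferSylow P hP).ker, ?_, ?_⟩
  · rw [commutator_def, Subgroup.commutator_le]
    intro a _ b _
    rw [MonoidHom.mem_ker, map_commutatorElement, commutatorElement_eq_one_iff_mul_comm]
    exact Subtype.ext (sylow_comm hcard (SetLike.coe_mem _) (SetLike.coe_mem _))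
  · rw [← hPc]
    exact (MonoidHom.ker_transferSylow_isComplement' P hP).symm.index_eq_card

theorem normal_of_commutator_le {G : Type*} [Group G] {N : Subgroup G} (h : commutator G ≤ N) :
    N.Normal := by
  refine ⟨fun n hn g => ?_⟩
  have h1 : g * n * g⁻¹ * n⁻¹ ∈ N := by
    apply h
    rw [commutator_def]
    exact Subgroup.commutator_mem_commutator (mem_top g) (mem_top n)
  have := mul_mem h1 hn
  simpa using this

theorem ppart_insert {s : Finset ℕ} {p : ℕ} (hps : p ∉ s) (n : ℕ) :
    ppart (insert p s) n = p ^ n.factorization p * ppart s n := Finset.prod_insert hps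

theorem prime_dvd_ppart {s : Finset ℕ} (hs : ∀ p ∈ s, p.Prime) {n q : ℕ} (hq : q.Prime)
    (h : q ∣ ppart s n) : q ∈ s := by
  obtain ⟨p, hp, hqp⟩ := (Prime.dvd_finsetProd_iff hq.prime _).1 h
  have := hq.dvd_of_dvd_pow hqp
  rw [(Nat.prime_dvd_prime_iff_eq hq (hs p hp)).1 this]
  exact hp

theorem coprime_ppart {s : Finset ℕ} (hs : ∀ p ∈ s, p.Prime) {p n k : ℕ} (hp : p.Prime)
    (hps : p ∉ s) : (p ^ k).Coprime (ppart s n) := by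
  apply Nat.Coprime.pow_left
  rw [Nat.Prime.coprime_iff_not_dvd hp]
  exact fun h => hps (prime_dvd_ppart hs hp h)

theorem exists_complement_finset {G : Type*} [Group G] [Finite G] (s : Finset ℕ)
    (hs : ∀ p ∈ s, p.Prime)
    (h : ∀ p ∈ s, ∃ N : Subgroup G, commutator G ≤ N ∧
      N.index = p ^ (Nat.card G).factorization p) :
    ∃ N : Subgroup G, commutator G ≤ N ∧ N.index = ppart s (Nat.card G) := by
  induction s using Finset.induction_on with
  | empty => exact ⟨⊤, le_top, by simp [ppart]⟩
  | insert p s hps ih =>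
    have hs' : ∀ q ∈ s, q.Prime := fun q hq => hs q (Finset.mem_insert_of_mem hq)
    obtain ⟨N, hN, hNi⟩ := ih hs' (fun q hq => h q (Finset.mem_insert_of_mem hq))
    obtain ⟨M, hM, hMi⟩ := h p (Finset.mem_insert_self _ _)
    refine ⟨M ⊓ N, le_inf hM hN, ?_⟩
    rw [ppart_insert hps, ← hNi, ← hMi]
    apply le_antisymm Subgroup.index_inf_le
    apply Nat.le_of_dvd (Nat.pos_of_ne_zero Subgroup.index_ne_zero_of_finite)
    apply Nat.Coprime.mul_dvd_of_dvd_of_dvd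
    · rw [hNi, hMi]
      exact coprime_ppart hs' (hs p (Finset.mem_insert_self _ _)) hps
    · exact Subgroup.index_dvd_of_le inf_le_left
    · exact Subgroup.index_dvd_of_le inf_le_right

theorem pow_dvd_ppart {s : Finset ℕ} {p : ℕ} (hp : p ∈ s) (n : ℕ) :
    p ^ n.factorization p ∣ ppart s n :=
  Finset.dvd_prod_of_mem (fun p => p ^ n.factorization p) hp

theorem coprime_card_ppart {G : Type*} [Group G] [Finite G] {s : Finset ℕ}
    (hs : ∀ p ∈ s, p.Prime) {N : Subgroup G} (hN : N.index = ppart s (Nat.card G)) :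
    (Nat.card N).Coprime (ppart s (Nat.card G)) := by
  apply Nat.coprime_of_dvd
  intro q hq h1 h2
  have hqs := prime_dvd_ppart hs hq h2
  have h3 : q * q ^ (Nat.card G).factorization q ∣ Nat.card G := by
    rw [← N.card_mul_index]
    nth_rewrite 1 [N.card_mul_index]
    rw [hN]
    exact mul_dvd_mul h1 (pow_dvd_ppart hqs _)
  rw [← pow_succ'] at h3
  exact Nat.pow_succ_factorization_not_dvd Nat.card_pos.ne' hq h3

theorem comm_of_disjoint {G : Type*} [Group G] {N K : Subgroup G} (hN : commutator G ≤ N)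
    (hd : Disjoint N K) {x y : G} (hx : x ∈ K) (hy : y ∈ K) : x * y = y * x := by
  rw [← commutatorElement_eq_one_iff_mul_comm]
  refine Subgroup.disjoint_def.1 hd (hN ?_) ?_
  · rw [commutator_def]
    exact Subgroup.commutator_mem_commutator (mem_top _) (mem_top _)
  · rw [commutatorElement_def]
    exact mul_mem (mul_mem (mul_mem hx hy) (inv_mem hx)) (inv_mem hy)

theorem relIndex_of_sup {G : Type*} [Group G] {L N : Subgroup G} [N.Normal] (h : L ⊔ N = ⊤) :
    N.relIndex L = N.index := by
  rw [← Subgroup.relIndex_sup_right, h, Subgroup.relIndex_top_right]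

theorem exists_hall {G : Type*} [Group G] [Finite G] {s : Finset ℕ}
    (hs : ∀ p ∈ s, p.Prime) {L N : Subgroup G} (hN : commutator G ≤ N)
    (hNi : N.index = ppart s (Nat.card G)) (hL : L ⊔ N = ⊤) :
    ∃ K : Subgroup G, K ≤ L ∧ Nat.card K = ppart s (Nat.card G) ∧
      ∀ x ∈ K, ∀ y ∈ K, x * y = y * x := by
  have hnorm := normal_of_commutator_le hN
  have hidx : (N.subgroupOf L).index = ppart s (Nat.card G) := by
    rw [← hNi]; exact relIndex_of_sup hL
  have hcop := coprime_card_ppart hs hNi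
  have hcd : Nat.card (N.subgroupOf L) ∣ Nat.card N := by
    have : Nat.card (N.subgroupOf L) = Nat.card ((N.subgroupOf L).map L.subtype) :=
      (Subgroup.card_map_of_injective L.subtype_injective).symm
    rw [this]
    apply Subgroup.card_dvd_of_le
    rw [Subgroup.subgroupOf_map_subtype]
    exact inf_le_left
  obtain ⟨K, hK⟩ := Subgroup.exists_right_complement'_of_coprime (N := N.subgroupOf L)
    (by rw [hidx]; exact hcop.coprime_dvd_left hcd)
  have hKc : Nat.card (K.map L.subtype) = ppart s (Nat.card G) := by
    rw [Subgroup.card_map_of_injective L.subtype_injective, ← hidx]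
    exact hK.symm.index_eq_card.symm
  refine ⟨K.map L.subtype, Subgroup.map_subtype_le _, hKc, ?_⟩
  intro x hx y hy
  exact comm_of_disjoint hN (Subgroup.disjoint_of_coprime_natCard (by rw [hKc]; exact hcop)) hx hy

theorem sylow_le_of_index {G : Type*} [Group G] [Finite G] {p : ℕ} (P : Sylow p G)
    {N : Subgroup G} [N.Normal] (h : p.Coprime N.index) : (P : Subgroup G) ≤ N := by
  intro x hx
  obtain ⟨k, hk⟩ := P.isPGroup' ⟨x, hx⟩
  have hk' : x ^ p ^ k = 1 := by simpa using congrArg Subtype.val hk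
  exact mem_of_coprime_pow (h.pow_left k) (by rw [hk']; exact one_mem _)
    (Subgroup.pow_index_mem N x)

theorem two_cent {G : Type*} [Group G] [Finite G] (P : Sylow 3 G) {M : Subgroup G}
    (hM : commutator G ≤ M) (hMi : M.index = 2 ^ (Nat.card G).factorization 2)
    (h : 5 * (2 ^ (Nat.card G).factorization 2 * 3 ^ (Nat.card G).factorization 3) <
      8 * kPi {2, 3} G) {y : G} (hyL : y ∈ normalizer ((P : Subgroup G) : Set G))
    (hy2 : IsPiElement {2} y) : y ∈ centralizer ((P : Subgroup G) : Set G) := by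
  have f2 : Fact (Nat.Prime 2) := ⟨Nat.prime_two⟩
  have f3 : Fact (Nat.Prime 3) := ⟨Nat.prime_three⟩
  have : Fintype G := Fintype.ofFinite G
  have hPc := P.card_eq_multiplicity
  by_contra hyC
  have hMn := normal_of_commutator_le hM
  set L := normalizer ((P : Subgroup G) : Set G) with hL
  have hPM : (P : Subgroup G) ≤ M := sylow_le_of_index P (by
    rw [hMi]; exact Nat.Coprime.pow_right _ (by norm_num))
  have hLM : L ⊔ M = ⊤ := P.normalizer_sup_eq_top' hPM
  have hy' : IsPiElement {2} (⟨y, hyL⟩ : L) := by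
    intro q hq hd
    rw [← Subgroup.orderOf_coe] at hd
    exact hy2 q hq hd
  obtain ⟨S', hS'⟩ := (piAux_isPGroup Nat.prime_two hy').exists_le_sylow
  set S : Subgroup G := (S' : Subgroup L).map L.subtype with hS
  have hSL : S ≤ L := Subgroup.map_subtype_le _
  have hyS : y ∈ S := ⟨⟨y, hyL⟩, hS' (mem_zpowers _), rfl⟩
  have hSc : Nat.card S = 2 ^ (Nat.card G).factorization 2 := by
    rw [hS, Subgroup.card_map_of_injective L.subtype_injective, S'.card_eq_multiplicity]
    congr 1
    apply le_antisymm
    · exact (Nat.factorization_le_iff_dvd Nat.card_pos.ne' Nat.card_pos.ne').2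
        (Subgroup.card_subgroup_dvd_card _) 2
    · rw [← Nat.prime_two.pow_dvd_iff_le_factorization Nat.card_pos.ne', ← hMi,
        ← relIndex_of_sup hLM]
      exact Subgroup.relIndex_dvd_card _ _
  set SG : Sylow 2 G := Sylow.ofCard S hSc with hSG
  have hSGS : (SG : Subgroup G) = S := Sylow.coe_ofCard S hSc
  have hpp : ppart {2} (Nat.card G) = 2 ^ (Nat.card G).factorization 2 := by simp [ppart]
  have hdisj : Disjoint M S := by
    apply Subgroup.disjoint_of_coprime_natCard
    have := coprime_card_ppart (G := G) (s := {2}) (by simpa using Nat.prime_two) (N := M)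
      (by rw [hpp, hMi])
    rwa [hpp, ← hSc] at this
  have hScomm : ∀ a ∈ S, ∀ b ∈ S, a * b = b * a := fun a ha b hb =>
    comm_of_disjoint hM hdisj ha hb
  set D : Subgroup G := S ⊓ centralizer ((P : Subgroup G) : Set G) with hD
  have hDS : 2 * Nat.card D ≤ Nat.card S := by
    apply pgroup_card_le Nat.prime_two inf_le_left hSc
    intro heq
    rw [← heq] at hyS
    exact hyC hyS.2
  set R : Finset G := Finset.univ.filter (· ∈ S) with hR
  have h1 := kPi_le_sum {2} {3} {2, 3} (by rfl) R (G := G) (fun x hx => by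
    obtain ⟨g, hg⟩ := sylow_conj Nat.prime_two SG x hx
    rw [hSGS] at hg
    exact ⟨_, by simpa [hR] using hg, g, rfl⟩)
  have hin : ∀ r ∈ D, 3 * kPi {3} (centralizer ({r} : Set G)) ≤ 2 * Nat.card P := by
    intro r hr
    set T := centralizer ({r} : Set G) with hT
    have hPT : (P : Subgroup G) ≤ T := by
      intro x hx
      rw [hT, mem_centralizer_singleton_iff]
      exact mem_centralizer_iff.1 hr.2 x hx
    have hyT : y ∈ T := by
      rw [hT, mem_centralizer_singleton_iff]
      exact hScomm y hyS r hr.1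
    have h2 := two_mul_kPi_le Nat.prime_three (P.subtype hPT)
    have hcP : Nat.card (P.subtype hPT) = Nat.card P := by
      have : Nat.card ((P : Subgroup G).subgroupOf T) = Nat.card P :=
        Nat.card_congr (Subgroup.subgroupOfEquivOfLe hPT).toEquiv
      exact this
    have h3 : 3 * Nat.card (fixN ((P.subtype hPT : Sylow 3 T) : Subgroup T)) ≤
        Nat.card (P.subtype hPT) := by
      apply pgroup_card_le Nat.prime_three (fixN_le _) (hcP.trans hPc)
      intro heq
      apply hyC
      rw [mem_centralizer_iff]
      intro x hx
      have hx' : (⟨x, hPT hx⟩ : T) ∈ fixN ((P.subtype hPT : Sylow 3 T) : Subgroup T) := by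
        rw [heq]; exact hx
      have hyN : (⟨y, hyT⟩ : T) ∈ normalizer (((P.subtype hPT : Sylow 3 T) : Subgroup T) : Set T) := by
        rw [mem_normalizer_iff]
        intro z
        exact mem_normalizer_iff.1 hyL z.1
      exact (congrArg Subtype.val (fixN_comm hx' hyN)).symm
    rw [hcP] at h2 h3
    omega
  have hout : ∀ r ∈ S, r ∉ D → 3 * kPi {3} (centralizer ({r} : Set G)) ≤ Nat.card P := by
    intro r hrS hrD
    set T := centralizer ({r} : Set G) with hT
    have h2 := kPi_le_ppart {3} (by simpa using Nat.prime_three) T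
    have h3 : ppart {3} (Nat.card T) = 3 ^ (Nat.card T).factorization 3 := by simp [ppart]
    rw [h3, Finset.coe_singleton] at h2
    have h4 : (Nat.card T).factorization 3 ≤ (Nat.card G).factorization 3 :=
      (Nat.factorization_le_iff_dvd Nat.card_pos.ne' Nat.card_pos.ne').2
        (Subgroup.card_subgroup_dvd_card _) 3
    have h5 : (Nat.card T).factorization 3 ≠ (Nat.card G).factorization 3 := by
      intro heq
      obtain ⟨Q'⟩ : Nonempty (Sylow 3 T) := inferInstance
      have hQc : Nat.card ((Q' : Subgroup T).map T.subtype) = 3 ^ (Nat.card G).factorization 3 := by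
        rw [Subgroup.card_map_of_injective T.subtype_injective, Q'.card_eq_multiplicity, heq]
      obtain ⟨g, hg⟩ := MulAction.exists_smul_eq G (Sylow.ofCard _ hQc) P
      have hr1 : g * r * g⁻¹ ∈ centralizer ((P : Subgroup G) : Set G) := by
        rw [mem_centralizer_iff]
        intro x hx
        rw [← hg] at hx
        have hx2 : g⁻¹ * x * g ∈ T := by
          have hx3 : x ∈ MulAut.conj g • ((Q' : Subgroup T).map T.subtype) := hx
          rw [Subgroup.mem_pointwise_smul_iff_inv_smul_mem] at hx3
          have hx4 := Subgroup.map_subtype_le _ hx3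
          rw [← map_inv, MulAut.smul_def, MulAut.conj_apply, inv_inv] at hx4
          exact hx4
        have hx5 := mem_centralizer_singleton_iff.1 hx2
        calc x * (g * r * g⁻¹) = g * ((g⁻¹ * x * g) * r) * g⁻¹ := by group
          _ = g * (r * (g⁻¹ * x * g)) * g⁻¹ := by rw [hx5]
          _ = _ := by group
      have hr1L : g * r * g⁻¹ ∈ L := by
        exact Subgroup.centralizer_le_normalizer _ hr1
      have hr2 : IsPiElement {2} r := by
        intro q hq hd
        have h6 : orderOf r ∣ 2 ^ (Nat.card G).factorization 2 := by
          rw [← hSc]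
          exact Subgroup.orderOf_dvd_natCard S hrS
        exact (Nat.prime_dvd_prime_iff_eq hq Nat.prime_two).1 (hq.dvd_of_dvd_pow (hd.trans h6))
      have hr1' : IsPiElement {2} (⟨g * r * g⁻¹, hr1L⟩ : L) := by
        intro q hq hd
        rw [← Subgroup.orderOf_coe] at hd
        exact piAux_conj hr2 g q hq hd
      obtain ⟨l, hl⟩ := sylow_conj Nat.prime_two S' _ hr1'
      have hr3 : (l : G) * (g * r * g⁻¹) * (l : G)⁻¹ ∈ S := ⟨_, hl, rfl⟩
      have hr4 : (l : G) * (g * r * g⁻¹) * (l : G)⁻¹ = r := by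
        rw [← mul_inv_eq_one]
        refine Subgroup.disjoint_def.1 hdisj (hM ?_) (mul_mem hr3 (inv_mem hrS))
        have h8 := Subgroup.commutator_mem_commutator (mem_top ((l : G) * g)) (mem_top r)
        rw [← _root_.commutator_def, commutatorElement_def] at h8
        convert h8 using 1
        group
      apply hrD
      refine ⟨hrS, mem_centralizer_iff.2 fun x hx => ?_⟩
      have hlx : (l : G)⁻¹ * x * l ∈ (P : Subgroup G) := by
        have := normalizer_conj_mem (inv_mem l.2) hx
        simpa using this
      have h6 := mem_centralizer_iff.1 hr1 _ hlx
      rw [← hr4]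
      calc x * (l * (g * r * g⁻¹) * (l : G)⁻¹) = l * (((l : G)⁻¹ * x * l) * (g * r * g⁻¹)) * (l : G)⁻¹ := by
            group
        _ = _ := by rw [h6]; group
    have h6 : 3 * 3 ^ (Nat.card T).factorization 3 ≤ Nat.card P := by
      rw [hPc, ← pow_succ']
      exact Nat.pow_le_pow_right (by norm_num) (lt_of_le_of_ne h4 h5)
    omega
  have hsum : 3 * kPi {2, 3} G ≤ Nat.card P * (Nat.card S + Nat.card D) := by
    calc 3 * kPi {2, 3} G ≤ ∑ r ∈ R, 3 * kPi {3} (centralizer ({r} : Set G)) := by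
          rw [← Finset.mul_sum]; exact Nat.mul_le_mul_left _ h1
      _ ≤ ∑ r ∈ R, (Nat.card P + if r ∈ D then Nat.card P else 0) := by
          apply Finset.sum_le_sum
          intro r hr
          have hrS : r ∈ S := (Finset.mem_filter.1 hr).2
          by_cases hrD : r ∈ D
          · rw [if_pos hrD]
            have := hin r hrD
            omega
          · rw [if_neg hrD]
            exact hout r hrS hrD
      _ = Nat.card P * (Nat.card S + Nat.card D) := by
          rw [Finset.sum_add_distrib, ← Finset.sum_filter, Finset.sum_const, Finset.sum_const,
            smul_eq_mul, smul_eq_mul]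
          have e1 : R.card = Nat.card S := by
            rw [Nat.card_eq_fintype_card, Fintype.card_subtype]
          have e2 : (R.filter (· ∈ D)).card = Nat.card D := by
            rw [Nat.card_eq_fintype_card, Fintype.card_subtype]
            congr 1
            ext x
            simp only [hR, Finset.mem_filter, Finset.mem_univ, true_and]
            exact ⟨fun hx => hx.2, fun hx => ⟨hx.1, hx⟩⟩
          rw [e1, e2]; ring
  rw [← hPc, ← hSc] at h
  have h7 : Nat.card P * (2 * Nat.card D) ≤ Nat.card P * Nat.card S := Nat.mul_le_mul_left _ hDS
  nlinarith

theorem piPart_eq_ppart (π : Set ℕ) (n : ℕ) :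
    piPart π n = ppart (n.primeFactors.filter (· ∈ π)) n := by
  rw [piPart, ppart, Finsupp.prod, Nat.support_factorization, Finset.prod_filter]

theorem kPi_le_inter (π : Set ℕ) (G : Type*) [Group G] [Finite G] :
    kPi π G ≤ kPi (((Nat.card G).primeFactors.filter (· ∈ π) : Finset ℕ) : Set ℕ) G := by
  rw [kPi_eq_ncard, kPi_eq_ncard]
  apply Set.ncard_le_ncard _ (Set.toFinite _)
  rintro c ⟨x, rfl, hx⟩
  refine ⟨x, rfl, fun q hq hd => ?_⟩
  rw [Finset.mem_coe, Finset.mem_filter, Nat.mem_primeFactors]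
  exact ⟨⟨hq, hd.trans (orderOf_dvd_natCard x), Nat.card_pos.ne'⟩, hx q hq hd⟩

theorem hall_main {G : Type*} [Group G] [Finite G] (s : Finset ℕ) (hs : ∀ p ∈ s, p.Prime)
    (h : 5 * ppart s (Nat.card G) < 8 * kPi (s : Set ℕ) G) :
    ∃ H : Subgroup G, Nat.card H = ppart s (Nat.card G) ∧ ∀ x ∈ H, ∀ y ∈ H, x * y = y * x := by
  have hsub : ∀ t ⊆ s, 5 * ppart t (Nat.card G) < 8 * kPi (t : Set ℕ) G := by
    intro t ht
    have h1 := kPi_mul_le s t hs ht G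
    have hps := ppart_pos s hs (Nat.card G)
    have hpt := ppart_pos t (fun p hp => hs p (ht hp)) (Nat.card G)
    have h2 := Nat.mul_lt_mul_of_pos_right h hpt
    have h3 : 5 * ppart t (Nat.card G) * ppart s (Nat.card G) <
        8 * kPi (t : Set ℕ) G * ppart s (Nat.card G) := by nlinarith
    exact lt_of_mul_lt_mul_right h3 (Nat.zero_le _)
  have hsing : ∀ p ∈ s, 5 * p ^ (Nat.card G).factorization p < 8 * kPi {p} G := by
    intro p hp
    have := hsub {p} (by simpa using hp)
    simpa [ppart] using this
  have hcompl : ∀ p ∈ s, p ≠ 3 → ∃ N : Subgroup G, commutator G ≤ N ∧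
      N.index = p ^ (Nat.card G).factorization p := fun p hp hp3 =>
    exists_complement (hs p hp) hp3 (hsing p hp)
  by_cases h3 : 3 ∈ s
  · have f3 : Fact (Nat.Prime 3) := ⟨Nat.prime_three⟩
    have hs' : ∀ p ∈ s.erase 3, p.Prime := fun p hp => hs p (Finset.mem_of_mem_erase hp)
    obtain ⟨N, hN, hNi⟩ := exists_complement_finset (G := G) (s.erase 3) hs'
      (fun p hp => hcompl p (Finset.mem_of_mem_erase hp) (Finset.ne_of_mem_erase hp))
    have hNn := normal_of_commutator_le hN
    obtain ⟨P⟩ : Nonempty (Sylow 3 G) := inferInstance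
    have hPc := P.card_eq_multiplicity
    have hcard := sylow_card_lt Nat.prime_three P (by rw [hPc]; exact hsing 3 h3)
    have hPN : (P : Subgroup G) ≤ N := sylow_le_of_index P (by
      rw [hNi]
      have := coprime_ppart (n := Nat.card G) (k := 1) hs' Nat.prime_three (Finset.notMem_erase 3 s)
      simpa using this)
    obtain ⟨K, hKL, hKc, hKcomm⟩ := exists_hall hs' hN hNi (P.normalizer_sup_eq_top' hPN)
    have hKP : ∀ k ∈ K, k ∈ centralizer ((P : Subgroup G) : Set G) := by
      intro k hk
      have hsq : k ^ 2 ∈ centralizer ((P : Subgroup G) : Set G) :=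
        mem_centralizer_iff.2 fun x hx => (sylow_sq Nat.prime_three P hcard (hKL hk) hx).symm
      obtain ⟨a, m, hm2, hkm⟩ := Nat.exists_eq_two_pow_mul_odd (orderOf_pos k).ne'
      have hodd : m.Coprime 2 := hm2.coprime_two_right
      refine mem_of_coprime_pow hodd ?_ hsq
      have hkm2 : (k ^ m) ^ 2 ^ a = 1 := by
        rw [← pow_mul, mul_comm, ← hkm, pow_orderOf_eq_one]
      by_cases h2 : 2 ∈ s
      · obtain ⟨M, hM, hMi⟩ := hcompl 2 h2 (by norm_num)
        refine two_cent P hM hMi ?_ (hKL (pow_mem hk m)) (piAux_pow_of hkm2 ?_)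
        · have := hsub {2, 3} (by
            intro q hq
            rw [Finset.mem_insert, Finset.mem_singleton] at hq
            rcases hq with rfl | rfl
            · exact h2
            · exact h3)
          simpa [ppart] using this
        · intro q hq hd
          exact (Nat.prime_dvd_prime_iff_eq hq Nat.prime_two).1 (hq.dvd_of_dvd_pow hd)
      · have hKodd : (2 ^ a).Coprime (Nat.card K) := by
          rw [hKc]
          exact coprime_ppart hs' Nat.prime_two (fun hh => h2 (Finset.mem_of_mem_erase hh))
        have : k ^ m = 1 := by
          rw [← orderOf_eq_one_iff]
          exact Nat.eq_one_of_dvd_coprimes hKodd (orderOf_dvd_of_pow_eq_one hkm2)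
            (Subgroup.orderOf_dvd_natCard K (pow_mem hk m))
        rw [this]
        exact one_mem _
    have hcop : (Nat.card P).Coprime (Nat.card K) := by
      rw [hPc, hKc]
      exact coprime_ppart hs' Nat.prime_three (Finset.notMem_erase 3 s)
    have hcomm : ∀ k ∈ K, ∀ x ∈ (P : Subgroup G), x * k = k * x := fun k hk x hx =>
      mem_centralizer_iff.1 (hKP k hk) x hx
    have hdis := Subgroup.disjoint_of_coprime_natCard hcop
    let f : P.toSubgroup × K →* G := MonoidHom.noncommCoprod (P : Subgroup G).subtype K.subtype
      (fun a k => hcomm k.1 k.2 a.1 a.2)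
    have hfa : ∀ a k, f (a, k) = a.1 * k.1 := fun a k => rfl
    have hf : Function.Injective f := by
      rw [injective_iff_map_eq_one]
      rintro ⟨a, k⟩ hak
      rw [hfa] at hak
      have h1 : a.1 = k.1⁻¹ := eq_inv_of_mul_eq_one_left hak
      have h2 : a.1 = 1 := Subgroup.disjoint_def.1 hdis a.2 (by rw [h1]; exact inv_mem k.2)
      have h4 : k.1 = 1 := by rwa [h2, one_mul] at hak
      exact Prod.ext (Subtype.ext h2) (Subtype.ext h4)
    refine ⟨f.range, ?_, ?_⟩
    · have h5 : Nat.card f.range = Nat.card (P.toSubgroup × K) :=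
        (Nat.card_congr (MonoidHom.ofInjective hf).toEquiv).symm
      rw [h5, Nat.card_prod, hPc, hKc, ← ppart_insert (Finset.notMem_erase 3 s),
        Finset.insert_erase h3]
    · rintro _ ⟨⟨a, k⟩, rfl⟩ _ ⟨⟨b, l⟩, rfl⟩
      rw [← map_mul, ← map_mul]
      congr 1
      exact Prod.ext (Subtype.ext (sylow_comm hcard a.2 b.2)) (Subtype.ext (hKcomm _ k.2 _ l.2))
  · obtain ⟨N, hN, hNi⟩ := exists_complement_finset (G := G) s hs
      (fun p hp => hcompl p hp (fun hh => h3 (hh ▸ hp)))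
    obtain ⟨K, -, hK1, hK2⟩ := exists_hall hs (L := ⊤) hN hNi (by simp)
    exact ⟨K, hK1, hK2⟩

end aux

/-- If `d_π(G) > 5/8` then `G` contains an abelian Hall `π`-subgroup. -/
theorem abelian_hall_subgroup_of_five_eighths_lt_dPi
    {G : Type*} [Group G] [Finite G] (π : Set ℕ)
    (hπ : ∀ p ∈ π, Nat.Prime p) (h : 5 / 8 < dPi π G) :
    ∃ H : Subgroup G, Nat.card H = piPart π (Nat.card G) ∧
      ∀ x y : H, x * y = y * x := by
  rw [dPi, piPart_eq_ppart] at h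
  rw [piPart_eq_ppart]
  have hs : ∀ p ∈ (Nat.card G).primeFactors.filter (· ∈ π), p.Prime := fun p hp =>
    Nat.prime_of_mem_primeFactors (Finset.mem_filter.1 hp).1
  have hpos := ppart_pos _ hs (Nat.card G)
  have hpos' : (0 : ℚ) < (ppart ((Nat.card G).primeFactors.filter (· ∈ π)) (Nat.card G) : ℚ) := by
    exact_mod_cast hpos
  rw [lt_div_iff₀ hpos'] at h
  have h1 : (5 : ℚ) * (ppart ((Nat.card G).primeFactors.filter (· ∈ π)) (Nat.card G) : ℚ) <
      8 * (kPi π G : ℚ) := by linarith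
  have h2 : 5 * ppart ((Nat.card G).primeFactors.filter (· ∈ π)) (Nat.card G) <
      8 * kPi π G := by exact_mod_cast h1
  have h3 := kPi_le_inter π G
  obtain ⟨H, hH, hc⟩ := hall_main (G := G) _ hs (by omega)
  exact ⟨H, hH, fun x y => Subtype.ext (hc x.1 x.2 y.1 y.2)⟩
end

section
/- Let G be a finite group and π a set of primes such that d_π(G) > 5/8. Then any two Hall π-subgroups of G are conjugate in G. -/
open scoped Classical Pointwise

universe u

lemma mem_conj_map {G : Type*} [Group G] (H : Subgroup G) (g x : G) :
    x ∈ H.map (MulAut.conj g).toMonoidHom ↔ g⁻¹ * x * g ∈ H := by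
  constructor
  · rintro ⟨y, hy, rfl⟩
    simpa [mul_assoc] using hy
  · intro h
    exact ⟨_, h, by simp [mul_assoc]⟩

lemma card_conj_map {G : Type*} [Group G] (H : Subgroup G) (g : G) :
    Nat.card (H.map (MulAut.conj g).toMonoidHom) = Nat.card H :=
  Subgroup.card_map_of_injective (MulAut.conj g).injective

lemma conj_map_map {G : Type*} [Group G] (H : Subgroup G) (g h : G) :
    (H.map (MulAut.conj g).toMonoidHom).map (MulAut.conj h).toMonoidHom
      = H.map (MulAut.conj (h * g)).toMonoidHom := by
  ext x
  simp only [mem_conj_map, mul_inv_rev, mul_assoc]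

/-- Sylow conjugacy inside an intermediate subgroup. -/
lemma sylow_conj_in {G : Type*} [Group G] [Finite G] (q : ℕ) (hq : q.Prime)
    (A B N : Subgroup G) (hA : Nat.card A = q ^ (Nat.card G).factorization q)
    (hB : Nat.card B = q ^ (Nat.card G).factorization q) (hAN : A ≤ N) (hBN : B ≤ N) :
    ∃ n ∈ N, A.map (MulAut.conj n).toMonoidHom = B := by
  have := Fact.mk hq
  have hfac : (Nat.card N).factorization q = (Nat.card G).factorization q := by
    apply le_antisymm
    · exact (Nat.factorization_le_iff_dvd Nat.card_pos.ne' Nat.card_pos.ne').2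
        (Subgroup.card_subgroup_dvd_card N) q
    · rw [← hq.pow_dvd_iff_le_factorization Nat.card_pos.ne', ← hA]
      exact Subgroup.card_dvd_of_le hAN
  have cA : Nat.card (A.subgroupOf N) = q ^ (Nat.card N).factorization q := by
    rw [hfac, ← hA]; exact Nat.card_congr (Subgroup.subgroupOfEquivOfLe hAN).toEquiv
  have cB : Nat.card (B.subgroupOf N) = q ^ (Nat.card N).factorization q := by
    rw [hfac, ← hB]; exact Nat.card_congr (Subgroup.subgroupOfEquivOfLe hBN).toEquiv
  obtain ⟨n, hn⟩ := MulAction.exists_smul_eq N (Sylow.ofCard _ cA) (Sylow.ofCard _ cB)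
  have hn2 := congrArg (fun S : Sylow q N => (S : Subgroup N)) hn
  simp only [Sylow.coe_subgroup_smul, Sylow.coe_ofCard] at hn2
  refine ⟨n, n.2, ?_⟩
  apply Subgroup.eq_of_le_of_card_ge
  · rintro x hx
    rw [mem_conj_map] at hx
    have hxN : x ∈ N := by
      have := N.mul_mem (N.mul_mem n.2 (hAN hx)) (N.inv_mem n.2)
      simpa [mul_assoc] using this
    have : (⟨x, hxN⟩ : N) ∈ B.subgroupOf N := by
      rw [← hn2, Subgroup.mem_pointwise_smul_iff_inv_smul_mem, Subgroup.mem_subgroupOf]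
      simpa [← map_inv, MulAut.smul_def] using hx
    simpa [Subgroup.mem_subgroupOf] using this
  · rw [card_conj_map, hA, hB]

lemma piPart_eq (π : Set ℕ) (n : ℕ) :
    piPart π n = ∏ q ∈ n.primeFactors with q ∈ π, q ^ n.factorization q := by
  rw [piPart, Finsupp.prod, Nat.support_factorization, Finset.prod_filter]

lemma piPart_pos (π : Set ℕ) (n : ℕ) : 0 < piPart π n := by
  rw [piPart_eq]
  refine Finset.prod_pos fun q hq => ?_
  exact pow_pos (Nat.prime_of_mem_primeFactors (Finset.mem_filter.1 hq).1).pos _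

lemma piPart_mul (π : Set ℕ) {a b : ℕ} (h : a.Coprime b) :
    piPart π (a * b) = piPart π a * piPart π b := by
  rw [piPart, Nat.factorization_mul_of_coprime h]
  exact Finsupp.prod_add_index_of_disjoint h.disjoint_primeFactors _

lemma piPart_prime_pow (π : Set ℕ) (q k : ℕ) (hq : q.Prime) (hqπ : q ∈ π) :
    piPart π (q ^ k) = q ^ k := by
  rw [piPart, hq.factorization_pow, Finsupp.prod_single_index] <;> simp [hqπ]

lemma piPart_not_dvd (π : Set ℕ) (q n : ℕ) (hn : ¬ q ∣ n) (hq : q.Prime) : ¬ q ∣ piPart π n := by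
  rw [piPart_eq, hq.prime.dvd_finsetProd_iff]
  rintro ⟨r, hr, hqr⟩
  have hr' := (Finset.mem_filter.1 hr).1
  have := (Nat.prime_dvd_prime_iff_eq hq (Nat.prime_of_mem_primeFactors hr')).1
    (hq.dvd_of_dvd_pow hqr)
  exact hn (this ▸ Nat.dvd_of_mem_primeFactors hr')

/-- A normal `q`-complement. -/
def HasPCompl (q : ℕ) (G : Type*) [Group G] : Prop :=
  ∃ K : Subgroup G, K.Normal ∧ ¬ q ∣ Nat.card K ∧ ∃ k, K.index = q ^ k

lemma HasPCompl.subgroup {q : ℕ} (hq : q.Prime) {G : Type*} [Group G] [Finite G]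
    (h : HasPCompl q G) (M : Subgroup G) : HasPCompl q M := by
  obtain ⟨K, hK, hd, k, hk⟩ := h
  refine ⟨K.subgroupOf M, inferInstance, ?_, ?_⟩
  · intro h
    apply hd
    refine h.trans ?_
    have : Nat.card (K.subgroupOf M) = Nat.card (K ⊓ M : Subgroup G) := by
      rw [← Subgroup.inf_subgroupOf_right]
      exact Nat.card_congr (Subgroup.subgroupOfEquivOfLe inf_le_right).toEquiv
    rw [this]
    exact Subgroup.card_dvd_of_le inf_le_left
  · have h1 : K.relIndex M ∣ q ^ k := hk ▸ Subgroup.relIndex_dvd_index_of_normal K M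
    obtain ⟨j, -, hj⟩ := (Nat.dvd_prime_pow hq).1 h1
    exact ⟨j, hj⟩

lemma hall_inter (π : Set ℕ) {q : ℕ} (hq : q.Prime) (hqπ : q ∈ π) {G : Type*} [Group G] [Finite G]
    (K : Subgroup G) (hKn : K.Normal) (hK : ¬ q ∣ Nat.card K) (k : ℕ) (hk : K.index = q ^ k)
    (H : Subgroup G) (hH : Nat.card H = piPart π (Nat.card G)) :
    Nat.card (H.subgroupOf K) = piPart π (Nat.card K) ∧
    Nat.card (H ⊓ K : Subgroup G) = piPart π (Nat.card K) ∧
    Nat.card H = piPart π (Nat.card K) * q ^ k := by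
  have e1 : Nat.card (H.subgroupOf K) = Nat.card (H ⊓ K : Subgroup G) := by
    rw [← Subgroup.inf_subgroupOf_right]
    exact Nat.card_congr (Subgroup.subgroupOfEquivOfLe inf_le_right).toEquiv
  have e2 : Nat.card (K.subgroupOf H) = Nat.card (H ⊓ K : Subgroup G) := by
    rw [← Subgroup.inf_subgroupOf_left]
    exact Nat.card_congr (Subgroup.subgroupOfEquivOfLe inf_le_left).toEquiv
  have hcop : ∀ j, (Nat.card K).Coprime (q ^ j) := fun j =>
    Nat.Coprime.pow_right _ ((Nat.Prime.coprime_iff_not_dvd hq).2 hK).symm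
  have e3 : Nat.card H = piPart π (Nat.card K) * q ^ k := by
    rw [hH, ← K.card_mul_index, hk, piPart_mul π (hcop k), piPart_prime_pow π q k hq hqπ]
  have h1 : K.relIndex H ∣ q ^ k := hk ▸ Subgroup.relIndex_dvd_index_of_normal K H
  obtain ⟨j, -, hj⟩ := (Nat.dvd_prime_pow hq).1 h1
  have e4 : Nat.card (H ⊓ K : Subgroup G) * q ^ j = Nat.card H := by
    rw [← e2, ← hj]; exact Subgroup.card_mul_index _
  have c1 : (Nat.card (H ⊓ K : Subgroup G)).Coprime (q ^ k) :=
    Nat.Coprime.coprime_dvd_left (Subgroup.card_dvd_of_le inf_le_right) (hcop k)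
  have c2 : (piPart π (Nat.card K)).Coprime (q ^ j) :=
    Nat.Coprime.pow_right _
      ((Nat.Prime.coprime_iff_not_dvd hq).2 (piPart_not_dvd π q _ hK hq)).symm
  have key : Nat.card (H ⊓ K : Subgroup G) = piPart π (Nat.card K) := by
    rw [e3] at e4
    exact Nat.dvd_antisymm (c1.dvd_of_dvd_mul_right ⟨_, e4.symm⟩)
      (c2.dvd_of_dvd_mul_right ⟨_, e4⟩)
  exact ⟨e1.trans key, key, e3⟩

lemma hall_conj_step (π : Set ℕ) {q : ℕ} (hq : q.Prime) (hqπ : q ∈ π) {G : Type*} [Group G]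
    [Finite G]
    (K : Subgroup G) (hKn : K.Normal) (hK : ¬ q ∣ Nat.card K) (k : ℕ) (hk : K.index = q ^ k)
    (IH : ∀ A B : Subgroup K, Nat.card A = piPart π (Nat.card K) →
      Nat.card B = piPart π (Nat.card K) →
      ∃ g : K, A.map (MulAut.conj g).toMonoidHom = B)
    (H₁ H₂ : Subgroup G) (h₁ : Nat.card H₁ = piPart π (Nat.card G))
    (h₂ : Nat.card H₂ = piPart π (Nat.card G)) :
    ∃ g : G, H₁.map (MulAut.conj g).toMonoidHom = H₂ := by
  have := Fact.mk hq
  obtain ⟨a1, -, -⟩ := hall_inter π hq hqπ K hKn hK k hk H₁ h₁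
  obtain ⟨a2, b2, c2⟩ := hall_inter π hq hqπ K hKn hK k hk H₂ h₂
  obtain ⟨g, hg⟩ := IH _ _ a1 a2
  set H := H₁.map (MulAut.conj (g : G)).toMonoidHom with hHdef
  have hH : Nat.card H = piPart π (Nat.card G) := by rw [hHdef, card_conj_map, h₁]
  obtain ⟨a3, b3, c3⟩ := hall_inter π hq hqπ K hKn hK k hk H hH
  have hinf : H ⊓ K = H₂ ⊓ K := by
    apply Subgroup.eq_of_le_of_card_ge
    · rintro x ⟨hx, hxK⟩
      have hx1 : (g : G)⁻¹ * x * g ∈ H₁ := (mem_conj_map _ _ _).1 hx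
      have : (⟨x, hxK⟩ : K) ∈ H₂.subgroupOf K := by
        rw [← hg, mem_conj_map, Subgroup.mem_subgroupOf]
        simpa using hx1
      exact ⟨by simpa [Subgroup.mem_subgroupOf] using this, hxK⟩
    · rw [b2, b3]
  have hfac : (Nat.card G).factorization q = k := by
    rw [← K.card_mul_index, hk, Nat.factorization_mul Nat.card_pos.ne' (pow_pos hq.pos k).ne']
    simp [Nat.factorization_eq_zero_of_not_dvd hK, hq.factorization_pow]
  obtain ⟨P₁, hP₁⟩ := Sylow.exists_subgroup_card_pow_prime q (G := H) (n := k) ⟨_, by rw [c3, mul_comm]⟩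
  obtain ⟨P₂, hP₂⟩ := Sylow.exists_subgroup_card_pow_prime q (G := H₂) (n := k) ⟨_, by rw [c2, mul_comm]⟩
  have cardP₁ : Nat.card (P₁.map H.subtype) = q ^ k := by
    rw [Subgroup.card_map_of_injective H.subtype_injective, hP₁]
  have cardP₂ : Nat.card (P₂.map H₂.subtype) = q ^ k := by
    rw [Subgroup.card_map_of_injective H₂.subtype_injective, hP₂]
  have hle : ∀ M : Subgroup G, M ≤ Subgroup.normalizer ((M ⊓ K : Subgroup G) : Set G) := by
    intro M x hx
    rw [Subgroup.mem_normalizer_iff]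
    intro y
    have hxy : ∀ x ∈ M, ∀ y, y ∈ M ⊓ K → x * y * x⁻¹ ∈ M ⊓ K := fun x hx y hy =>
      ⟨M.mul_mem (M.mul_mem hx hy.1) (M.inv_mem hx), hKn.conj_mem _ hy.2 _⟩
    refine ⟨hxy x hx y, fun h => ?_⟩
    have := hxy x⁻¹ (M.inv_mem hx) _ h
    simpa [mul_assoc] using this
  obtain ⟨n, hn, hnP⟩ := sylow_conj_in q hq (P₁.map H.subtype) (P₂.map H₂.subtype)
    (Subgroup.normalizer ((H₂ ⊓ K : Subgroup G) : Set G)) (by rw [hfac, cardP₁]) (by rw [hfac, cardP₂])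
    ((Subgroup.map_subtype_le P₁).trans (by rw [← hinf]; exact hle H))
    ((Subgroup.map_subtype_le P₂).trans (hle H₂))
  refine ⟨n * g, ?_⟩
  rw [← conj_map_map, ← hHdef]
  have hsub : (H₂ ⊓ K) ⊔ P₂.map H₂.subtype = H₂ := by
    apply Subgroup.eq_of_le_of_card_ge (sup_le inf_le_left (Subgroup.map_subtype_le P₂))
    apply Nat.le_of_dvd Nat.card_pos
    rw [c2]
    apply Nat.Coprime.mul_dvd_of_dvd_of_dvd
    · exact Nat.Coprime.pow_right _
        ((Nat.Prime.coprime_iff_not_dvd hq).2 (piPart_not_dvd π q _ hK hq)).symm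
    · rw [← b2]; exact Subgroup.card_dvd_of_le le_sup_left
    · rw [← cardP₂]; exact Subgroup.card_dvd_of_le le_sup_right
  symm
  apply Subgroup.eq_of_le_of_card_ge
  · rw [← hsub]
    apply sup_le
    · intro x hx
      rw [mem_conj_map]
      have := (Subgroup.mem_normalizer_iff.1 (Subgroup.inv_mem _ hn) x).1 hx
      rw [inv_inv] at this
      have h3 : n⁻¹ * x * n ∈ H ⊓ K := by rw [hinf]; exact this
      exact h3.1
    · rw [← hnP]
      exact Subgroup.map_mono (Subgroup.map_subtype_le P₁)
  · rw [card_conj_map, hH, h₂]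

lemma hall_conj_induct (π : Set ℕ) (S : Finset ℕ) : ∀ (G : Type u) [Group G] [Finite G],
    (∀ q ∈ S, q.Prime ∧ HasPCompl q G) →
    (∀ q ∈ π, q ∣ Nat.card G → q ∈ S ∨ q = 3) →
    ∀ H K : Subgroup G, Nat.card H = piPart π (Nat.card G) →
      Nat.card K = piPart π (Nat.card G) →
      ∃ g : G, H.map (MulAut.conj g).toMonoidHom = K := by
  induction S using Finset.induction_on with
  | empty =>
    intro G _ _ _ h2 H K hH hK
    by_cases h3 : 3 ∈ π ∧ 3 ∣ Nat.card G
    · have e : piPart π (Nat.card G) = 3 ^ (Nat.card G).factorization 3 := by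
        rw [piPart_eq, show (Nat.card G).primeFactors.filter (· ∈ π) = {3} from ?_,
          Finset.prod_singleton]
        ext q
        simp only [Finset.mem_filter, Finset.mem_singleton, Nat.mem_primeFactors]
        constructor
        · rintro ⟨⟨a, b, c⟩, d⟩
          simpa using h2 q d b
        · rintro rfl
          exact ⟨⟨Nat.prime_three, h3.2, Nat.card_pos.ne'⟩, h3.1⟩
      rw [e] at hH hK
      obtain ⟨n, -, hn⟩ := sylow_conj_in 3 Nat.prime_three H K ⊤ hH hK le_top le_top
      exact ⟨n, hn⟩
    · have e : piPart π (Nat.card G) = 1 := by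
        rw [piPart_eq]
        apply Finset.prod_eq_one
        intro q hq
        simp only [Finset.mem_filter, Nat.mem_primeFactors] at hq
        have : q = 3 := by simpa using h2 q hq.2 hq.1.2.1
        subst this
        exact absurd ⟨hq.2, hq.1.2.1⟩ h3
      rw [e] at hH hK
      rw [Subgroup.card_eq_one] at hH hK
      subst hH hK
      exact ⟨1, by simp⟩
  | insert q S hqS IH =>
    intro G _ _ h1 h2 H K hH hK
    by_cases hqπ : q ∈ π
    · obtain ⟨hq, M, hMn, hMd, k, hk⟩ := h1 q (Finset.mem_insert_self _ _)
      refine hall_conj_step π hq hqπ M hMn hMd k hk (IH M ?_ ?_) H K hH hK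
      · intro r hr
        obtain ⟨a, b⟩ := h1 r (Finset.mem_insert_of_mem hr)
        exact ⟨a, b.subgroup a M⟩
      · intro r hr hrd
        rcases h2 r hr (hrd.trans (Subgroup.card_subgroup_dvd_card M)) with h | h
        · rcases Finset.mem_insert.1 h with h | h
          · subst h; exact absurd hrd hMd
          · exact Or.inl h
        · exact Or.inr h
    · refine IH G (fun r hr => h1 r (Finset.mem_insert_of_mem hr)) ?_ H K hH hK
      intro r hr hrd
      rcases h2 r hr hrd with h | h
      · rcases Finset.mem_insert.1 h with h | h
        · subst h; exact absurd hr hqπ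
        · exact Or.inl h
      · exact Or.inr h

lemma pElement_conj_mem {G : Type*} [Group G] [Finite G] (p : ℕ) [Fact p.Prime] (P : Sylow p G)
    (x : G) (k : ℕ) (h : orderOf x = p ^ k) : ∃ g : G, g * x * g⁻¹ ∈ P := by
  have hz : IsPGroup p (Subgroup.zpowers x) := IsPGroup.of_card (n := k) (by rw [Nat.card_zpowers, h])
  obtain ⟨Q, hQ⟩ := hz.exists_le_sylow
  obtain ⟨g, hg⟩ := MulAction.exists_smul_eq G Q P
  refine ⟨g, ?_⟩
  rw [← hg]
  have hx : x ∈ Q := hQ (Subgroup.mem_zpowers x)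
  have := Subgroup.smul_mem_pointwise_smul x (MulAut.conj g) (Q : Subgroup G) hx
  exact this

lemma piElement_order {G : Type*} [Group G] [Finite G] (p : ℕ) (x : G)
    (h : IsPiElement {p} x) : ∃ k, orderOf x = p ^ k :=
  ⟨_, Nat.eq_prime_pow_of_unique_prime_dvd (n := orderOf x) (p := p) (orderOf_pos x).ne'
    (fun {d} hd hdx => h d hd hdx)⟩

lemma burnside_part {G : Type*} [Group G] [Finite G] (p : ℕ) (hp : p.Prime) (hp3 : p ≠ 3)
    (h : 5 * p ^ (Nat.card G).factorization p < 8 * kPi {p} G) : HasPCompl p G := by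
  have := Fact.mk hp
  obtain ⟨P⟩ : Nonempty (Sylow p G) := inferInstance
  have hcP : Nat.card P = p ^ (Nat.card G).factorization p := P.card_eq_multiplicity
  rw [← hcP] at h
  set N := Subgroup.normalizer (P : Set G) with hN
  set F : Subgroup G := (P : Subgroup G) ⊓ Subgroup.centralizer (N : Set G) with hF
  have hFmem : ∀ x, x ∈ F ↔ x ∈ P ∧ ∀ n ∈ N, n * x * n⁻¹ = x := by
    intro x
    rw [hF, Subgroup.mem_inf, Subgroup.mem_centralizer_iff]
    refine and_congr Iff.rfl (forall₂_congr fun n _ => ?_)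
    rw [mul_inv_eq_iff_eq_mul]
  have hFP : F ≤ P := inf_le_left
  have hNP : ∀ n ∈ N, ∀ x ∈ P, n * x * n⁻¹ ∈ P := fun n hn x hx =>
    (Subgroup.mem_normalizer_iff.1 hn x).1 hx
  have hNF : ∀ n ∈ N, ∀ x, n * x * n⁻¹ ∈ F → x ∈ F := by
    intro n hn x hx
    have h1 := ((hFmem _).1 hx).2 _ (N.inv_mem hn)
    have h2 : x = n * x * n⁻¹ := by
      rw [← h1]; group
    rw [h2]; exact hx
  have : Fintype G := Fintype.ofFinite G
  let Ps : Finset G := Finset.univ.filter (· ∈ P)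
  let Fs : Finset G := Finset.univ.filter (· ∈ F)
  have cPs : Ps.card = Nat.card P := by
    rw [Nat.card_eq_fintype_card]; exact (Fintype.card_subtype _).symm
  have cFs : Fs.card = Nat.card F := by
    rw [Nat.card_eq_fintype_card]; exact (Fintype.card_subtype _).symm
  have hsub : Fs ⊆ Ps := by
    intro x hx
    simp only [Fs, Ps, Finset.mem_filter, Finset.mem_univ, true_and] at hx ⊢
    exact hFP hx
  have hk : kPi {p} G ≤ (Ps.image (ConjClasses.mk : G → ConjClasses G)).card := by
    rw [kPi, Nat.card_coe_set_eq, ← Set.ncard_coe_finset]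
    apply Set.ncard_le_ncard _ (Finset.finite_toSet _)
    rintro c ⟨x, rfl, hx⟩
    obtain ⟨k, hk⟩ := piElement_order p x hx
    obtain ⟨g, hg⟩ := pElement_conj_mem p P x k hk
    rw [Finset.mem_coe, Finset.mem_image]
    refine ⟨g * x * g⁻¹, by simpa [Ps] using hg, ?_⟩
    rw [ConjClasses.mk_eq_mk_iff_isConj]
    exact (isConj_iff.2 ⟨g, rfl⟩).symm
  have hsplit : Ps.image (ConjClasses.mk : G → ConjClasses G) =
      Fs.image ConjClasses.mk ∪ (Ps \ Fs).image ConjClasses.mk := by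
    rw [← Finset.image_union, Finset.union_sdiff_of_subset hsub]
  have hhalf : 2 * ((Ps \ Fs).image (ConjClasses.mk : G → ConjClasses G)).card ≤ (Ps \ Fs).card := by
    apply Finset.mul_card_image_le_card
    intro c hc
    obtain ⟨x, hx, rfl⟩ := Finset.mem_image.1 hc
    simp only [Fs, Ps, Finset.mem_sdiff, Finset.mem_filter, Finset.mem_univ, true_and] at hx
    have hx2 : ∃ n ∈ N, n * x * n⁻¹ ≠ x := by
      by_contra! hcon
      exact hx.2 ((hFmem x).2 ⟨hx.1, hcon⟩)
    obtain ⟨n, hn, hne⟩ := hx2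
    apply Nat.succ_le_of_lt
    rw [Finset.one_lt_card]
    refine ⟨x, ?_, n * x * n⁻¹, ?_, hne.symm⟩
    · simp only [Fs, Ps, Finset.mem_sdiff, Finset.mem_filter, Finset.mem_univ, true_and]
      exact ⟨hx, trivial⟩
    · simp only [Fs, Ps, Finset.mem_sdiff, Finset.mem_filter, Finset.mem_univ, true_and]
      refine ⟨⟨hNP n hn x hx.1, fun hh => hx.2 (hNF n hn x hh)⟩, ?_⟩
      rw [ConjClasses.mk_eq_mk_iff_isConj]
      exact (isConj_iff.2 ⟨n, rfl⟩).symm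
  have hcount : Nat.card P < 4 * Nat.card F := by
    have h1 := Finset.card_union_le (Fs.image (ConjClasses.mk : G → ConjClasses G))
      ((Ps \ Fs).image ConjClasses.mk)
    rw [← hsplit] at h1
    have h2 : (Fs.image (ConjClasses.mk : G → ConjClasses G)).card ≤ Fs.card := Finset.card_image_le
    have h3 := Finset.card_sdiff_add_card_eq_card hsub
    omega
  have hidx : Nat.card F * F.relIndex P = Nat.card P := by
    have h1 := Subgroup.card_mul_index (F.subgroupOf (P : Subgroup G))
    rw [Nat.card_congr (Subgroup.subgroupOfEquivOfLe hFP).toEquiv] at h1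
    exact h1
  have hlt : F.relIndex P < 4 := by
    by_contra hcon
    push Not at hcon
    have := Nat.mul_le_mul_left (Nat.card F) hcon
    omega
  obtain ⟨j, -, hj⟩ := (Nat.dvd_prime_pow hp).1 (hcP ▸ Dvd.intro_left _ hidx : F.relIndex P ∣ _)
  have hcomm : ∀ x ∈ P, ∀ n ∈ N, n * x * n⁻¹ = x := by
    intro x hx n hn
    by_cases hxF : x ∈ F
    · exact ((hFmem x).1 hxF).2 n hn
    have hne1 : F.relIndex P ≠ 1 := by
      intro h1
      rw [Subgroup.relIndex_eq_one] at h1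
      exact hxF (h1 hx)
    have hj0 : j ≠ 0 := by
      rintro rfl
      exact hne1 (by simpa using hj)
    have hpd : p ∣ F.relIndex P := hj ▸ dvd_pow_self p hj0
    have h2 : F.relIndex P = 2 := by
      have hpos : 0 < F.relIndex P := hj ▸ pow_pos hp.pos j
      have hne3 : F.relIndex P ≠ 3 := by
        intro h3
        rw [h3] at hpd
        exact hp3 ((Nat.prime_dvd_prime_iff_eq hp Nat.prime_three).1 hpd)
      omega
    have hdiff : ∀ y ∈ P, y ∉ F → x⁻¹ * y ∈ F := by
      intro y hy hyF
      have := (Subgroup.mul_mem_iff_of_index_two (H := F.subgroupOf (P : Subgroup G)) h2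
        (a := ⟨x⁻¹, P.inv_mem hx⟩) (b := ⟨y, hy⟩)).2
      simp only [Subgroup.mem_subgroupOf, Subgroup.coe_mul] at this
      apply this
      simp [hxF, hyF]
    have hFc : ∀ f ∈ F, ∀ m ∈ N, Commute m f := by
      intro f hf m hm
      exact mul_inv_eq_iff_eq_mul.1 (((hFmem f).1 hf).2 m hm)
    have hPN : ∀ y ∈ P, y ∈ N := fun y hy => Subgroup.le_normalizer hy
    have hPx : ∀ y ∈ P, Commute y x := by
      intro y hy
      by_cases hyF : y ∈ F
      · exact (hFc y hyF x (hPN x hx)).symm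
      · have h1 := hFc _ (hdiff y hy hyF) x (hPN x hx)
        have h3 : Commute x (x * (x⁻¹ * y)) := (Commute.refl x).mul_right h1
        rw [mul_inv_cancel_left] at h3
        exact h3.symm
    set f := x⁻¹ * (n * x * n⁻¹) with hfdef
    have hf : f ∈ F := hdiff _ (hNP n hn x hx) (fun hh => hxF (hNF n hn x hh))
    have hpow : ∀ k : ℕ, n ^ k * x * (n ^ k)⁻¹ = x * f ^ k := by
      intro k
      induction k with
      | zero => simp
      | succ k ih =>
        have e1 : n ^ (k + 1) * x * (n ^ (k + 1))⁻¹ = n * (n ^ k * x * (n ^ k)⁻¹) * n⁻¹ := by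
          rw [pow_succ']; group
        have e3 : f ^ k * n⁻¹ = n⁻¹ * f ^ k := (((hFc f hf n hn).inv_left).pow_right k).eq.symm
        have e4 : x * f = n * x * n⁻¹ := by rw [hfdef, mul_inv_cancel_left]
        calc _ = n * x * (f ^ k * n⁻¹) := by rw [e1, ih]; simp only [mul_assoc]
          _ = n * x * n⁻¹ * f ^ k := by rw [e3]; simp only [mul_assoc]
          _ = _ := by rw [← e4, pow_succ', mul_assoc]
    have hc1 : Commute (n ^ Nat.card P) x := by
      have h1 := hpow (Nat.card P)
      have h3 : f ^ Nat.card P = 1 := by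
        have := pow_card_eq_one' (x := (⟨f, hFP hf⟩ : P))
        exact congrArg Subtype.val this
      rw [h3, mul_one] at h1
      exact mul_inv_eq_iff_eq_mul.1 h1
    have hc2 : Commute (n ^ (P : Subgroup G).relIndex N) x := by
      apply hPx
      have : ((P : Subgroup G).subgroupOf N).Normal := Subgroup.normal_in_normalizer
      have := Subgroup.pow_index_mem ((P : Subgroup G).subgroupOf N) ⟨n, hn⟩
      exact this
    have hcop : Nat.Coprime (Nat.card P) ((P : Subgroup G).relIndex N) := by
      rw [hcP]
      apply Nat.Coprime.pow_left
      rw [Nat.Prime.coprime_iff_not_dvd hp]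
      intro hd
      exact P.not_dvd_index (hd.trans (Subgroup.relIndex_dvd_index_of_le Subgroup.le_normalizer))
    have hc3 : n ∈ Subgroup.centralizer {x} := by
      have m1 : n ^ Nat.card P ∈ Subgroup.centralizer {x} :=
        Subgroup.mem_centralizer_singleton_iff.2 hc1.eq
      have m2 : n ^ (P : Subgroup G).relIndex N ∈ Subgroup.centralizer {x} :=
        Subgroup.mem_centralizer_singleton_iff.2 hc2.eq
      have hb := Nat.gcd_eq_gcd_ab (Nat.card P) ((P : Subgroup G).relIndex N)
      rw [hcop.gcd_eq_one] at hb
      have : n = (n ^ Nat.card P) ^ (Nat.gcdA (Nat.card P) ((P : Subgroup G).relIndex N)) *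
          (n ^ (P : Subgroup G).relIndex N) ^ (Nat.gcdB (Nat.card P) ((P : Subgroup G).relIndex N)) := by
        rw [← zpow_natCast, ← zpow_natCast, ← zpow_mul, ← zpow_mul, ← zpow_add, ← hb]
        simp
      rw [this]
      exact Subgroup.mul_mem _ (Subgroup.zpow_mem _ m1 _) (Subgroup.zpow_mem _ m2 _)
    exact mul_inv_eq_iff_eq_mul.2 (Subgroup.mem_centralizer_singleton_iff.1 hc3)
  have hP : Subgroup.normalizer (P : Set G) ≤ Subgroup.centralizer (P : Set G) := by
    intro n hn
    rw [Subgroup.mem_centralizer_iff]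
    intro x hx
    exact (mul_inv_eq_iff_eq_mul.1 (hcomm x hx n hn)).symm
  refine ⟨(MonoidHom.transferSylow P hP).ker, inferInstance,
    MonoidHom.not_dvd_card_ker_transferSylow P hP, (Nat.card G).factorization p, ?_⟩
  rw [← hcP]
  exact (MonoidHom.ker_transferSylow_isComplement' P hP).symm.index_eq_card

lemma kPi_step {G : Type*} [Group G] [Finite G] (σ π : Set ℕ) (p : ℕ) (hp : p.Prime)
    (hσ : π ⊆ insert p σ) :
    kPi π G ≤ kPi σ G * p ^ (Nat.card G).factorization p := by
  have := Fact.mk hp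
  let T : Set (ConjClasses G) := {c | ∃ x : G, ConjClasses.mk x = c ∧ IsPiElement σ x}
  have hrep : ∀ c : ConjClasses G, ∃ x : G, ConjClasses.mk x = c := fun c => ConjClasses.exists_rep c
  choose r hr using hrep
  let S : ∀ c : ConjClasses G, Sylow p (Subgroup.centralizer {r c}) := fun c => default
  let f : (Σ c : T, (S c.1 : Subgroup (Subgroup.centralizer {r c.1}))) → ConjClasses G :=
    fun z => ConjClasses.mk (r z.1.1 * (z.2 : Subgroup.centralizer {r z.1.1}))
  have hcard : Nat.card (Σ c : T, (S c.1 : Subgroup (Subgroup.centralizer {r c.1}))) ≤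
      kPi σ G * p ^ (Nat.card G).factorization p := by
    have : Fintype T := Fintype.ofFinite T
    rw [Nat.card_sigma]
    have : ∀ c ∈ (Finset.univ : Finset T),
        Nat.card (S c.1 : Subgroup (Subgroup.centralizer {r c.1})) ≤
        p ^ (Nat.card G).factorization p := by
      intro c _
      rw [Sylow.card_eq_multiplicity]
      apply Nat.pow_le_pow_right hp.pos
      exact (Nat.factorization_le_iff_dvd Nat.card_pos.ne' Nat.card_pos.ne').2
        (Subgroup.card_subgroup_dvd_card _) p
    refine (Finset.sum_le_card_nsmul _ _ _ this).trans ?_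
    rw [smul_eq_mul, Finset.card_univ, ← Nat.card_eq_fintype_card]
    exact le_rfl
  refine le_trans ?_ hcard
  rw [kPi, Nat.card_coe_set_eq]
  have hsub : {c : ConjClasses G | ∃ x : G, ConjClasses.mk x = c ∧ IsPiElement π x} ⊆
      Set.range f := by
    rintro c ⟨z, rfl, hz⟩
    -- decompose z
    have hn0 : orderOf z ≠ 0 := (orderOf_pos z).ne'
    set a := p ^ (orderOf z).factorization p with ha
    set m := orderOf z / a with hm
    have ham : a * m = orderOf z := Nat.ordProj_mul_ordCompl_eq_self _ _
    have hpm : ¬ p ∣ m := Nat.not_dvd_ordCompl hp hn0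
    have hcop : Nat.Coprime a m :=
      Nat.Coprime.pow_left _ ((Nat.Prime.coprime_iff_not_dvd hp).2 hpm)
    have hb := Nat.gcd_eq_gcd_ab a m
    rw [hcop.gcd_eq_one] at hb
    set x := (z ^ a) ^ (Nat.gcdA a m) with hx
    set y := (z ^ m) ^ (Nat.gcdB a m) with hy
    have hzxy : x * y = z := by
      rw [hx, hy, ← zpow_natCast, ← zpow_natCast, ← zpow_mul, ← zpow_mul, ← zpow_add, ← hb]
      simp
    have hxy : Commute x y :=
      (((Commute.refl z).pow_pow a m).zpow_zpow _ _)
    have hxm : x ^ m = 1 := by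
      rw [hx, ← zpow_natCast, zpow_comm, zpow_natCast, ← pow_mul, ham, pow_orderOf_eq_one, one_zpow]
    have hya : y ^ a = 1 := by
      rw [hy, ← zpow_natCast, zpow_comm, zpow_natCast, ← pow_mul, mul_comm, ham,
        pow_orderOf_eq_one, one_zpow]
    have hxσ : IsPiElement σ x := by
      intro q hq hqx
      have hqm : q ∣ m := hqx.trans (orderOf_dvd_of_pow_eq_one hxm)
      rcases hσ (hz q hq (hqm.trans (Dvd.intro_left _ ham))) with h | h
      · subst h; exact absurd hqm hpm
      · exact h
    obtain ⟨k, -, hk⟩ := (Nat.dvd_prime_pow hp).1 (orderOf_dvd_of_pow_eq_one hya)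
    have hconj : IsConj x (r (ConjClasses.mk x)) :=
      (ConjClasses.mk_eq_mk_iff_isConj.1 (hr (ConjClasses.mk x))).symm
    obtain ⟨g, hg⟩ := isConj_iff.1 hconj
    set c := ConjClasses.mk x with hc
    have hy' : g * y * g⁻¹ ∈ Subgroup.centralizer {r c} := by
      rw [Subgroup.mem_centralizer_singleton_iff, ← hg]
      have := hxy.eq
      calc g * y * g⁻¹ * (g * x * g⁻¹) = g * (y * x) * g⁻¹ := by group
        _ = g * (x * y) * g⁻¹ := by rw [this]
        _ = _ := by group
    have hord : orderOf (⟨g * y * g⁻¹, hy'⟩ : Subgroup.centralizer {r c}) = p ^ k := by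
      rw [← Subgroup.orderOf_coe, ← hk]
      exact (MulAut.conj g).orderOf_eq y
    obtain ⟨h, hh⟩ := pElement_conj_mem p (S c) _ k hord
    refine ⟨⟨⟨c, x, rfl, hxσ⟩, ⟨_, hh⟩⟩, ?_⟩
    simp only [f]
    rw [ConjClasses.mk_eq_mk_iff_isConj]
    apply IsConj.symm
    rw [isConj_iff]
    refine ⟨h * g, ?_⟩
    have hcr : (h : G) * r c = r c * h := Subgroup.mem_centralizer_singleton_iff.1 h.2
    simp only [Subgroup.coe_mul, Subgroup.coe_inv]
    generalize (h : G) = h' at hcr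
    calc h' * g * z * (h' * g)⁻¹ = h' * (g * x * g⁻¹) * (g * y * g⁻¹) * h'⁻¹ := by
          conv_lhs => rw [← hzxy]
          group
      _ = _ := by rw [hg, hcr]; group
  refine (Set.ncard_le_ncard hsub (Set.toFinite _)).trans ?_
  rw [← Nat.card_coe_set_eq]
  exact Finite.card_range_le f

lemma kPi_finset {G : Type*} [Group G] [Finite G] (p : ℕ) (S : Finset ℕ) :
    (∀ q ∈ S, q.Prime) → ∀ π : Set ℕ, π ⊆ insert p (S : Set ℕ) →
    kPi π G ≤ kPi {p} G * ∏ q ∈ S, q ^ (Nat.card G).factorization q := by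
  induction S using Finset.induction_on with
  | empty =>
    intro _ π hπ
    simp only [Finset.prod_empty, mul_one]
    apply Nat.card_mono (Set.toFinite _)
    rintro c ⟨x, hx, hxπ⟩
    exact ⟨x, hx, fun q hq hqx => by simpa using hπ (hxπ q hq hqx)⟩
  | insert q S hqS IH =>
    intro hS π hπ
    have h1 := kPi_step (G := G) (insert p (S : Set ℕ)) π q (hS q (Finset.mem_insert_self _ _))
      (by rw [Set.insert_comm]; simpa using hπ)
    have h2 := IH (fun r hr => hS r (Finset.mem_insert_of_mem hr)) (insert p (S : Set ℕ)) le_rfl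
    rw [Finset.prod_insert hqS]
    calc _ ≤ _ := h1
      _ ≤ _ := Nat.mul_le_mul_right _ h2
      _ = _ := by ring

lemma kPi_bound {G : Type*} [Group G] [Finite G] (π : Set ℕ) (p : ℕ) (hp : p ∈ π) (hpp : p.Prime)
    (hpd : p ∣ Nat.card G) (h : 5 / 8 < dPi π G) :
    5 * p ^ (Nat.card G).factorization p < 8 * kPi {p} G := by
  set n := Nat.card G with hn
  have hnz : n ≠ 0 := Nat.card_pos.ne'
  set S := (n.primeFactors.filter (· ∈ π)) with hS
  have hpS : p ∈ S := by simp [hS, hpp, hpd, hp, hnz]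
  have hpart : piPart π n = p ^ n.factorization p * ∏ q ∈ S.erase p, q ^ n.factorization q := by
    rw [piPart_eq, Finset.mul_prod_erase S (fun q => q ^ n.factorization q) hpS]
  have h0 : kPi π G ≤ kPi (S : Set ℕ) G := by
    apply Nat.card_mono (Set.toFinite _)
    rintro c ⟨x, hx, hxπ⟩
    refine ⟨x, hx, fun q hq hqx => ?_⟩
    have : q ∣ n := hqx.trans (orderOf_dvd_natCard x)
    simp [hS, hq, this, hxπ q hq hqx, hnz]
  have h1 := kPi_finset (G := G) p (S.erase p)
    (fun q hq => Nat.prime_of_mem_primeFactors (Finset.mem_filter.1 (Finset.mem_of_mem_erase hq)).1)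
    (S : Set ℕ) (by rw [← Finset.coe_insert, Finset.insert_erase hpS])
  have hpos := piPart_pos π n
  rw [dPi, lt_div_iff₀ (by exact_mod_cast hpos)] at h
  have h' : 5 * piPart π n < 8 * kPi π G := by
    have : (5 : ℚ) * piPart π n < 8 * kPi π G := by linarith
    exact_mod_cast this
  set Q := ∏ q ∈ S.erase p, q ^ n.factorization q
  rw [hpart] at h'
  apply Nat.lt_of_mul_lt_mul_right (a := Q)
  calc _ = 5 * (p ^ n.factorization p * Q) := by ring
    _ < 8 * kPi π G := h'
    _ ≤ 8 * (kPi {p} G * Q) := Nat.mul_le_mul_left _ (h0.trans h1)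
    _ = _ := by ring

/-- If `d_π(G) > 5/8` then any two Hall `π`-subgroups of `G` are conjugate. -/
theorem hall_subgroups_isConj_of_five_eighths_lt_dPi
    {G : Type*} [Group G] [Finite G] (π : Set ℕ)
    (hπ : ∀ p ∈ π, Nat.Prime p) (h : 5 / 8 < dPi π G) :
    ∀ H K : Subgroup G, Nat.card H = piPart π (Nat.card G) →
      Nat.card K = piPart π (Nat.card G) →
      ∃ g : G, H.map (MulAut.conj g).toMonoidHom = K := by
  refine hall_conj_induct π ((Nat.card G).primeFactors.filter (fun q => q ∈ π ∧ q ≠ 3)) G ?_ ?_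
  · intro q hq
    simp only [Finset.mem_filter, Nat.mem_primeFactors] at hq
    exact ⟨hq.1.1, burnside_part q hq.1.1 hq.2.2 (kPi_bound π q hq.2.1 hq.1.1 hq.1.2.1 h)⟩
  · intro q hq hqd
    by_cases h3 : q = 3
    · exact Or.inr h3
    · left
      simp only [Finset.mem_filter, Nat.mem_primeFactors]
      exact ⟨⟨hπ q hq, hqd, Nat.card_pos.ne'⟩, hq, h3⟩
end

section
/- Let G be a finite group and π a set of primes such that d_π(G) > 5/8. Then every π-subgroup of G (i.e., every subgroup whose order has all its prime divisors in π) is contained in some Hall π-subgroup of G. -/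
open scoped Classical Pointwise

namespace PiHall

/-- the `S`-part of `n` for a finset `S`. -/
noncomputable def pp (S : Finset ℕ) (n : ℕ) : ℕ := ∏ p ∈ S, p ^ (n.factorization p)

lemma piPart_eq_pp (π : Set ℕ) (n : ℕ) :
    piPart π n = pp (n.primeFactors.filter (· ∈ π)) n := by
  unfold piPart pp
  rw [Nat.prod_factorization_eq_prod_primeFactors, Finset.prod_filter]

lemma pp_pos {S : Finset ℕ} (hS : ∀ p ∈ S, p.Prime) (n : ℕ) : 0 < pp S n :=
  Finset.prod_pos fun p hp => pow_pos (hS p hp).pos _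

lemma pp_insert {S : Finset ℕ} {p : ℕ} (hp : p ∉ S) (n : ℕ) :
    pp (insert p S) n = p ^ (n.factorization p) * pp S n := Finset.prod_insert hp

lemma pp_dvd_pp (S : Finset ℕ) {m n : ℕ} (h : m ∣ n) (hn : n ≠ 0) : pp S m ∣ pp S n := by
  refine Finset.prod_dvd_prod_of_dvd _ _ fun p _ => pow_dvd_pow _ ?_
  exact (Nat.factorization_le_iff_dvd (ne_zero_of_dvd_ne_zero hn h) hn).2 h p

lemma factorization_pp {S : Finset ℕ} (hS : ∀ p ∈ S, p.Prime) (n q : ℕ) :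
    (pp S n).factorization q = if q ∈ S then n.factorization q else 0 := by
  unfold pp
  rw [Nat.factorization_prod (fun p hp => pow_ne_zero _ (hS p hp).ne_zero)]
  rw [Finsupp.finsetSum_apply]
  rw [Finset.sum_congr rfl (g := fun p => if p = q then n.factorization q else 0)]
  · simp
  · intro p hp
    rw [(hS p hp).factorization_pow]
    by_cases h : p = q
    · subst h; simp
    · simp [h]

lemma pp_dvd {S : Finset ℕ} (hS : ∀ p ∈ S, p.Prime) {n : ℕ} (hn : n ≠ 0) : pp S n ∣ n := by
  rw [← Nat.factorization_le_iff_dvd (pp_pos hS n).ne' hn]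
  intro q
  rw [factorization_pp hS]
  split_ifs <;> simp

lemma not_dvd_index {G : Type*} [Group G] [Finite G] {S : Finset ℕ} (hS : ∀ p ∈ S, p.Prime)
    (H : Subgroup G) (hH : Nat.card H = pp S (Nat.card G)) {q : ℕ} (hq : q ∈ S) :
    ¬ q ∣ H.index := by
  have h0 : Nat.card G ≠ 0 := Nat.card_pos.ne'
  have h1 := H.card_mul_index
  have hi : H.index ≠ 0 := H.index_ne_zero_of_finite
  have hc : Nat.card H ≠ 0 := Nat.card_pos.ne'
  have h2 := congrArg (fun n => n.factorization q) h1
  simp only [Nat.factorization_mul hc hi, Finsupp.add_apply] at h2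
  rw [hH, factorization_pp hS, if_pos hq] at h2
  intro hd
  have := (hS q hq).factorization_pos_of_dvd hi hd
  omega

/-- decomposition of an element into a `p`-part and a part of order prime to `p` -/
lemma decomp {G : Type*} [Group G] [Finite G] {p : ℕ} (hp : p.Prime) (z : G) :
    ∃ a b : G, a * b = z ∧ Commute a b ∧ (∃ k, orderOf a ∣ p ^ k) ∧
      orderOf b ∣ orderOf z ∧ ¬ p ∣ orderOf b := by
  obtain ⟨k, m, hm, hn⟩ := Nat.exists_eq_pow_mul_and_not_dvd (orderOf_pos z).ne' p hp.ne_one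
  have hco : (p ^ k).Coprime m := Nat.Coprime.pow_left _ ((hp.coprime_iff_not_dvd).2 hm)
  obtain ⟨e, he1, he2⟩ := Nat.chineseRemainder hco 1 0
  obtain ⟨f, hf1, hf2⟩ := Nat.chineseRemainder hco 0 1
  have hm' : orderOf (z ^ f) ∣ m := by
    rw [orderOf_dvd_iff_pow_eq_one, ← pow_mul, ← orderOf_dvd_iff_pow_eq_one, hn]
    exact Nat.mul_dvd_mul_right ((Nat.modEq_zero_iff_dvd).1 hf1) _
  refine ⟨z ^ e, z ^ f, ?_, (Commute.refl z).pow_pow _ _, ⟨k, ?_⟩, ?_, ?_⟩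
  · rw [← pow_add]
    conv_rhs => rw [← pow_one z]
    rw [pow_eq_pow_iff_modEq, hn, ← Nat.modEq_and_modEq_iff_modEq_mul hco]
    exact ⟨by simpa using he1.add hf1, by simpa using he2.add hf2⟩
  · rw [orderOf_dvd_iff_pow_eq_one, ← pow_mul, ← orderOf_dvd_iff_pow_eq_one, hn, mul_comm (p ^ k)]
    exact Nat.mul_dvd_mul_right ((Nat.modEq_zero_iff_dvd).1 he2) _
  · exact orderOf_pow_dvd f
  · exact fun h => hm (h.trans hm')

/-- the finset of classes of `p`-elements. -/
noncomputable def clp (p : ℕ) (G : Type*) [Group G] [Fintype (ConjClasses G)] :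
    Finset (ConjClasses G) :=
  Finset.univ.filter fun c => ∃ x : G, ConjClasses.mk x = c ∧ ∃ k, orderOf x ∣ p ^ k

lemma kPi_insert_le {G : Type*} [Group G] [Finite G] [Fintype (ConjClasses G)] {S : Finset ℕ}
    {p : ℕ} (hp : p.Prime) :
    kPi (↑(insert p S)) G ≤ ∑ c ∈ clp p G,
      kPi (↑S) (Subgroup.centralizer ({(Quotient.out c : G)} : Set G)) := by
  let X (c : ConjClasses G) : Set (ConjClasses (Subgroup.centralizer ({(Quotient.out c : G)} : Set G))) :=
    {c | ∃ x, ConjClasses.mk x = c ∧ IsPiElement (↑S) x}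
  have h1 : ∑ c ∈ clp p G, kPi (↑S) (Subgroup.centralizer ({(Quotient.out c : G)} : Set G)) =
      Nat.card (Σ c : clp p G, X c) := by
    rw [Nat.card_sigma, ← Finset.sum_coe_sort]
    rfl
  rw [h1]
  let T : Set (ConjClasses G) :=
    {c : ConjClasses G | ∃ x : G, ConjClasses.mk x = c ∧ IsPiElement (↑(insert p S)) x}
  change Nat.card T ≤ _
  have key : ∀ t : T, ∃ (c : clp p G) (d : X c) 
      (b : Subgroup.centralizer ({(Quotient.out c.1 : G)} : Set G)),
      ConjClasses.mk b = d.1 ∧ ConjClasses.mk ((Quotient.out c.1 : G) * b) = t.1 := by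
    rintro ⟨t, z, rfl, hz⟩
    obtain ⟨a, b, hab, hcomm, ⟨k, hk⟩, hb, hpb⟩ := decomp hp z
    have hout : ConjClasses.mk (Quotient.out (ConjClasses.mk a)) = ConjClasses.mk a :=
      Quotient.out_eq _
    obtain ⟨g, hg⟩ := isConj_iff.1 (ConjClasses.mk_eq_mk_iff_isConj.1 hout.symm)
    let b' : G := g * b * g⁻¹
    have hb' : b' ∈ Subgroup.centralizer ({(Quotient.out (ConjClasses.mk a) : G)} : Set G) := by
      rw [Subgroup.mem_centralizer_singleton_iff, ← hg]
      have := hcomm.eq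
      simp only [b']
      simp only [mul_assoc, inv_mul_cancel_left]
      rw [← mul_assoc b, ← this, mul_assoc]
    refine ⟨⟨ConjClasses.mk a, ?_⟩, ⟨ConjClasses.mk ⟨b', hb'⟩, ⟨b', hb'⟩, rfl, ?_⟩, ⟨b', hb'⟩, rfl, ?_⟩
    · simp only [clp, Finset.mem_filter, Finset.mem_univ, true_and]
      exact ⟨a, rfl, k, hk⟩
    · intro q hq hqd
      rw [Subgroup.orderOf_mk] at hqd
      have hob : orderOf b' = orderOf b := by
        have := orderOf_injective (MulAut.conj g).toMonoidHom (MulAut.conj g).injective b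
        simpa [b'] using this
      rw [hob] at hqd
      have := hz q hq (hqd.trans hb)
      simp only [Finset.coe_insert, Set.mem_insert_iff] at this
      rcases this with rfl | h
      · exact absurd hqd hpb
      · exact h
    · simp only
      rw [ConjClasses.mk_eq_mk_iff_isConj]
      refine (isConj_iff.2 ⟨g, ?_⟩ : IsConj z _).symm
      rw [← hg, ← hab]
      simp [b', mul_assoc]
  choose fc fd fb h2 h3 using key
  refine Nat.card_le_card_of_injective (fun t => (⟨fc t, fd t⟩ : Σ c : clp p G, X c)) ?_
  intro t t' htt
  simp only at htt
  have aux : ∀ (c c' : clp p G) (d : X c) (d' : X c') 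
     (b : Subgroup.centralizer ({(Quotient.out c.1 : G)} : Set G)) 
     (b' : Subgroup.centralizer ({(Quotient.out c'.1 : G)} : Set G)),
      (⟨c, d⟩ : Σ c : clp p G, X c) = ⟨c', d'⟩ → ConjClasses.mk b = d.1 → 
      ConjClasses.mk b' = d'.1 →
      ConjClasses.mk ((Quotient.out c.1 : G) * b) = ConjClasses.mk ((Quotient.out c'.1 : G) * b') := by
    intro c c' d d' b b' h
    cases h
    intro h1 h2
    obtain ⟨⟨g, hgc⟩, hg⟩ := isConj_iff.1 (ConjClasses.mk_eq_mk_iff_isConj.1 (h1.trans h2.symm))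
    rw [ConjClasses.mk_eq_mk_iff_isConj, isConj_iff]
    refine ⟨g, ?_⟩
    rw [Subgroup.mem_centralizer_singleton_iff] at hgc
    rw [← hg]
    simp only [Subgroup.coe_mul, InvMemClass.coe_inv]
    rw [← mul_assoc, hgc]; simp [mul_assoc]
  apply Subtype.ext
  rw [← h3 t, ← h3 t']
  exact aux _ _ _ _ _ _ htt (h2 t) (h2 t')

end PiHall

namespace PiHall

/-- The weight of an element of a Sylow subgroup `P`. -/
noncomputable def wt {G : Type*} [Group G] {p : ℕ} (P : Sylow p G) (x : G) : ℚ :=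
  if x ∈ Subgroup.centralizer (Subgroup.normalizer (P : Set G) : Set G) then 1 else 1 / 2

lemma wt_le_one {G : Type*} [Group G] {p : ℕ} (P : Sylow p G) (x : G) : wt P x ≤ 1 := by
  unfold wt; split_ifs <;> norm_num

lemma half_le_wt {G : Type*} [Group G] {p : ℕ} (P : Sylow p G) (x : G) : 1 / 2 ≤ wt P x := by
  unfold wt; split_ifs <;> norm_num

lemma sum_clp_le {G : Type*} [Group G] [Fintype G] [Fintype (ConjClasses G)] {p : ℕ}
    [hp : Fact p.Prime] (P : Sylow p G) (w : G → ℚ) (hw : ∀ x, 0 ≤ w x)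
    (hc : ∀ x y, IsConj x y → w x = w y) :
    ∑ c ∈ clp p G, w (Quotient.out c) ≤ ∑ x : G with x ∈ P, w x * wt P x := by
  have h1 : ∑ c ∈ clp p G, ∑ x : G with (x ∈ P ∧ ConjClasses.mk x = c), w x * wt P x ≤
      ∑ x : G with x ∈ P, w x * wt P x := by
    have hpos : ∀ x, 0 ≤ w x * wt P x := fun x =>
      mul_nonneg (hw x) (le_trans (by norm_num) (half_le_wt P x))
    rw [← Finset.sum_fiberwise (Finset.univ.filter (· ∈ P)) (ConjClasses.mk)
      (fun x => w x * wt P x)]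
    simp_rw [Finset.filter_filter]
    exact Finset.sum_le_sum_of_subset_of_nonneg (Finset.subset_univ _)
      fun c _ _ => Finset.sum_nonneg fun x _ => hpos x
  refine le_trans (Finset.sum_le_sum fun c hcc => ?_) h1
  simp only [clp, Finset.mem_filter, Finset.mem_univ, true_and] at hcc
  obtain ⟨x, rfl, k, hk⟩ := hcc
  set c := ConjClasses.mk x with hcdef
  -- an element of the class inside P
  have hx : ∃ y ∈ P, ConjClasses.mk y = c := by
    have hpg : IsPGroup p (Subgroup.zpowers x) := by
      obtain ⟨j, -, hj⟩ := (Nat.dvd_prime_pow hp.out).1 hk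
      exact IsPGroup.of_card (n := j) (by rw [Nat.card_zpowers, hj])
    obtain ⟨Q, hQ⟩ := hpg.exists_le_sylow
    obtain ⟨g, hg⟩ := MulAction.exists_smul_eq G Q P
    refine ⟨g * x * g⁻¹, ?_, ?_⟩
    · rw [← hg]
      have : x ∈ Q := hQ (Subgroup.mem_zpowers x)
      have h2 := Subgroup.smul_mem_pointwise_smul x (MulAut.conj g) (Q : Subgroup G) this
      simp only [MulAut.smul_def, MulAut.conj_apply] at h2
      exact h2
    · rw [hcdef, ConjClasses.mk_eq_mk_iff_isConj]
      exact (isConj_iff.2 ⟨g, rfl⟩ : IsConj x _).symm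
  have hwc : ∀ y, ConjClasses.mk y = c → w y = w (Quotient.out c) := by
    intro y hy
    apply hc
    rw [← ConjClasses.mk_eq_mk_iff_isConj, hy]
    exact (Quotient.out_eq c).symm
  have h2 : ∑ x : G with (x ∈ P ∧ ConjClasses.mk x = c), w x * wt P x =
      w (Quotient.out c) * ∑ x : G with (x ∈ P ∧ ConjClasses.mk x = c), wt P x := by
    rw [Finset.mul_sum]
    refine Finset.sum_congr rfl fun y hy => ?_
    rw [hwc y (by simpa using (Finset.mem_filter.1 hy).2.2)]
  rw [h2]
  refine le_mul_of_one_le_right (hw _) ?_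
  obtain ⟨y, hyP, hyc⟩ := hx
  have hnn : ∀ x, 0 ≤ wt P x := fun x => le_trans (by norm_num) (half_le_wt P x)
  by_cases hF : y ∈ Subgroup.centralizer (Subgroup.normalizer (P : Set G) : Set G)
  · have : wt P y = 1 := if_pos hF
    rw [← this]
    exact Finset.single_le_sum (f := wt P) (fun x _ => hnn x) (by simp [hyP, hyc])
  · rw [Subgroup.mem_centralizer_iff] at hF
    push Not at hF
    obtain ⟨n, hn, hny⟩ := hF
    have hne : n * y * n⁻¹ ≠ y := fun h => hny (mul_inv_eq_iff_eq_mul.1 h)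
    have hnP : n * y * n⁻¹ ∈ P := (Subgroup.mem_normalizer_iff.1 hn y).1 hyP
    have hnc : ConjClasses.mk (n * y * n⁻¹) = c := by
      rw [← hyc, ConjClasses.mk_eq_mk_iff_isConj]
      exact (isConj_iff.2 ⟨n, rfl⟩ : IsConj y _).symm
    have hsub : ({y, n * y * n⁻¹} : Finset G) ⊆
        Finset.univ.filter (fun x : G => x ∈ P ∧ ConjClasses.mk x = c) := by
      intro z hz
      simp only [Finset.mem_insert, Finset.mem_singleton] at hz
      rcases hz with rfl | rfl
      · simp [hyP, hyc]
      · simp only [Finset.mem_filter, Finset.mem_univ, true_and]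
        exact ⟨hnP, hnc⟩
    refine le_trans ?_ (Finset.sum_le_sum_of_subset_of_nonneg hsub fun x _ _ => hnn x)
    rw [Finset.sum_pair hne.symm]
    have := half_le_wt P y
    have := half_le_wt P (n * y * n⁻¹)
    linarith

lemma card_centralizer_conj {G : Type*} [Group G] {x y : G} (h : IsConj x y) :
    Nat.card (Subgroup.centralizer ({x} : Set G)) =
      Nat.card (Subgroup.centralizer ({y} : Set G)) := by
  obtain ⟨g, rfl⟩ := isConj_iff.1 h
  refine Nat.card_congr ((MulAut.conj g).toEquiv.subtypeEquiv fun a => ?_)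
  simp only [Subgroup.mem_centralizer_singleton_iff]
  simp only [MulEquiv.toEquiv_eq_coe, EquivLike.coe_coe, MulAut.conj_apply]
  constructor
  · intro h
    simp only [mul_assoc, inv_mul_cancel_left]
    rw [← mul_assoc a, h, mul_assoc]
  · intro h
    simp only [mul_assoc, inv_mul_cancel_left, mul_right_inj] at h
    simpa [← mul_assoc] using h

lemma card_sylow_filter {G : Type*} [Group G] [Fintype G] {p : ℕ} [Fact p.Prime] (P : Sylow p G) :
    (Finset.univ.filter (fun x : G => x ∈ P)).card = p ^ (Nat.card G).factorization p := by
  rw [← P.card_eq_multiplicity, ← Fintype.card_subtype, ← Nat.card_eq_fintype_card]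
  rfl

lemma kPi_le_of {G : Type*} [Group G] [Fintype G] {S : Finset ℕ} {p : ℕ}
    [hp : Fact p.Prime] (P : Sylow p G)
    (hS : ∀ (C : Subgroup G), kPi (↑S) C ≤ pp S (Nat.card C)) :
    (kPi (↑(insert p S)) G : ℚ) ≤ ∑ x : G with x ∈ P,
      (pp S (Nat.card (Subgroup.centralizer ({x} : Set G))) : ℚ) * wt P x := by
  have := Fintype.ofFinite (ConjClasses G)
  refine le_trans ?_ (sum_clp_le P
    (fun x => (pp S (Nat.card (Subgroup.centralizer ({x} : Set G))) : ℚ)) (fun x => by positivity)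
    (fun x y hxy => by simp only [card_centralizer_conj hxy]))
  have := kPi_insert_le (G := G) (S := S) hp.out
  refine le_trans (Nat.cast_le.2 this) ?_
  push_cast
  exact Finset.sum_le_sum fun c _ => by exact_mod_cast hS _

lemma kPi_le_pp (S : Finset ℕ) : (∀ p ∈ S, p.Prime) → ∀ (G : Type*) [Group G] [Finite G],
    kPi (↑S) G ≤ pp S (Nat.card G) := by
  induction S using Finset.induction_on with
  | empty =>
    intro _ G _ _
    simp only [pp, Finset.prod_empty, kPi]
    have : Subsingleton {c : ConjClasses G | ∃ x : G, ConjClasses.mk x = c ∧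
        IsPiElement (↑(∅ : Finset ℕ)) x} := by
      have aux : ∀ x : G, IsPiElement (↑(∅ : Finset ℕ)) x → x = 1 := by
        intro x hx
        by_contra h
        have h1 : orderOf x ≠ 1 := fun h' => h (orderOf_eq_one_iff.1 h')
        obtain ⟨q, hq, hqd⟩ := Nat.exists_prime_and_dvd h1
        simpa using hx q hq hqd
      constructor
      rintro ⟨_, x, rfl, hx⟩ ⟨_, y, rfl, hy⟩
      simp [aux x hx, aux y hy]
    exact Finite.card_le_one_iff_subsingleton.2 this
  | insert p S hpS ih =>
    intro hS G _ _
    have : Fact p.Prime := ⟨hS p (by simp)⟩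
    have hS' : ∀ q ∈ S, q.Prime := fun q hq => hS q (by simp [hq])
    have := Fintype.ofFinite G
    let P : Sylow p G := default
    have h1 := kPi_le_of (S := S) P (fun C => ih hS' C)
    have h2 : ∑ x : G with x ∈ P,
      (pp S (Nat.card (Subgroup.centralizer ({x} : Set G))) : ℚ) * wt P x ≤
      ∑ x : G with x ∈ P, (pp S (Nat.card G) : ℚ) := by
      refine Finset.sum_le_sum fun x _ => ?_
      refine le_trans (mul_le_of_le_one_right (by positivity) (wt_le_one P x)) ?_
      exact_mod_cast Nat.le_of_dvd (pp_pos hS' _)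
        (pp_dvd_pp S (Subgroup.card_subgroup_dvd_card _) Nat.card_pos.ne')
    rw [Finset.sum_const, card_sylow_filter, nsmul_eq_mul] at h2
    rw [pp_insert hpS]
    exact_mod_cast h1.trans h2

end PiHall

namespace PiHall

lemma relIndex_mul_card' {G : Type*} [Group G] {F P : Subgroup G} (h : F ≤ P) :
    F.relIndex P * Nat.card F = Nat.card P := by
  rw [mul_comm, ← Subgroup.card_mul_index (F.subgroupOf P),
    Nat.card_congr (Subgroup.subgroupOfEquivOfLe h).toEquiv]
  rfl

lemma eq_of_prime_index {G : Type*} [Group G] [Finite G] {F D P : Subgroup G} {k : ℕ}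
    (hk : k.Prime) (hc : Nat.card P = k * Nat.card F) (hFD : F ≤ D) (hDP : D ≤ P) {a : G}
    (haD : a ∈ D) (haF : a ∉ F) : D = P := by
  obtain ⟨j, hj⟩ := Subgroup.card_dvd_of_le hFD
  obtain ⟨i, hi⟩ := Subgroup.card_dvd_of_le hDP
  have hF0 : 0 < Nat.card F := Nat.card_pos
  have hk2 : k = j * i := by
    apply Nat.eq_of_mul_eq_mul_left hF0
    rw [mul_comm, ← hc, hi, hj, mul_assoc]
  have hj1 : j ≠ 1 := by
    rintro rfl
    have : F = D := Subgroup.eq_of_le_of_card_ge hFD (by omega)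
    exact haF (this ▸ haD)
  have hi1 : i = 1 := by
    rcases (Nat.dvd_prime hk).1 (⟨i, hk2⟩ : j ∣ k) with h | h
    · exact absurd h hj1
    · subst h
      exact Nat.eq_of_mul_eq_mul_left hk.pos (by omega)
  exact Subgroup.eq_of_le_of_card_ge hDP (by rw [hi, hi1]; omega)

/-- The subgroup of `P` fixed by the normalizer of `P`. -/
noncomputable def fixP {G : Type*} [Group G] {p : ℕ} (P : Sylow p G) : Subgroup G :=
  (P : Subgroup G) ⊓ Subgroup.centralizer (Subgroup.normalizer (P : Set G) : Set G)

lemma sum_bound {G : Type*} [Group G] [Fintype G] {p : ℕ} [Fact p.Prime] (P : Sylow p G)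
    (w : G → ℚ) (W t : ℚ) (hw1 : ∀ x, w x ≤ W)
    (hw2 : ∀ x ∈ P, x ∉ fixP P → w x ≤ t * W) :
    ∑ x : G with x ∈ P, w x * wt P x ≤
      W * ((Nat.card (fixP P) : ℚ) +
        ((Nat.card (P : Subgroup G) : ℚ) - (Nat.card (fixP P) : ℚ)) * (t / 2)) := by
  have h1 : ∑ x : G with x ∈ P, w x * wt P x ≤
      ∑ x : G with x ∈ P, (if x ∈ fixP P then W - t * W / 2 else 0) +
      ∑ x : G with x ∈ P, (t * W / 2) := by
    rw [← Finset.sum_add_distrib]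
    refine Finset.sum_le_sum fun x hx => ?_
    have hxP : x ∈ P := by simpa using hx
    by_cases hF : x ∈ fixP P
    · have : wt P x = 1 := if_pos hF.2
      rw [this, if_pos hF]
      linarith [hw1 x]
    · have : wt P x = 1 / 2 := if_neg fun h => hF ⟨hxP, h⟩
      rw [this, if_neg hF]
      linarith [hw2 x hxP hF]
  refine h1.trans (le_of_eq ?_)
  rw [← Finset.sum_filter, Finset.sum_const, Finset.sum_const, Finset.filter_filter]
  have h2 : (Finset.univ.filter (fun x : G => x ∈ P ∧ x ∈ fixP P)).card = Nat.card (fixP P) := by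
    rw [Nat.card_eq_fintype_card, Fintype.card_subtype]
    congr 1
    ext x
    simp only [Finset.mem_filter, Finset.mem_univ, true_and]
    exact ⟨fun h => h.2, fun h => ⟨h.1, h⟩⟩
  rw [h2, card_sylow_filter, ← P.card_eq_multiplicity, nsmul_eq_mul, nsmul_eq_mul]
  ring

lemma dich {G : Type*} [Group G] [Finite G] {S : Finset ℕ} {p : ℕ} (hpS : p ∉ S)
    (hS : ∀ q ∈ S, q.Prime) [hp : Fact p.Prime] (P : Sylow p G)
    (h : (5 / 8 : ℚ) * pp (insert p S) (Nat.card G) < kPi (↑(insert p S)) G) :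
    Subgroup.normalizer (P : Set G) ≤ Subgroup.centralizer (P : Set G) ∨
    (p = 3 ∧ ∃ a ∈ P, pp S (Nat.card (Subgroup.centralizer ({a} : Set G))) = pp S (Nat.card G) ∧
      (P : Subgroup G) ≤ Subgroup.centralizer ({a} : Set G) ∧
      ∀ y ∈ Subgroup.normalizer (P : Set G), y ∈ Subgroup.centralizer ({a} : Set G) →
        y ∈ Subgroup.centralizer (P : Set G)) := by
  have := Fintype.ofFinite G
  set W : ℚ := (pp S (Nat.card G) : ℚ) with hW
  have hWpos : 0 < W := Nat.cast_pos.2 (pp_pos hS _)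
  set w : G → ℚ := fun x => (pp S (Nat.card (Subgroup.centralizer ({x} : Set G))) : ℚ) with hwdef
  have hdvd : ∀ x : G, pp S (Nat.card (Subgroup.centralizer ({x} : Set G))) ∣ pp S (Nat.card G) :=
    fun x => pp_dvd_pp S (Subgroup.card_subgroup_dvd_card _) Nat.card_pos.ne'
  have hw1 : ∀ x, w x ≤ W := fun x =>
    Nat.cast_le.2 (Nat.le_of_dvd (pp_pos hS _) (hdvd x))
  have hk := kPi_le_of (S := S) P (fun C => kPi_le_pp S hS C)
  rw [pp_insert hpS, ← P.card_eq_multiplicity, Nat.cast_mul] at h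
  set n : ℕ := Nat.card (P : Subgroup G) with hn
  set f : ℕ := Nat.card (fixP P) with hf
  have hFP : fixP P ≤ (P : Subgroup G) := inf_le_left
  obtain ⟨k, hkf⟩ := Subgroup.card_dvd_of_le hFP
  have hfpos : 0 < f := Nat.card_pos
  have hnpos : 0 < n := Nat.card_pos
  -- first bound
  have hb1 := h.trans_le (hk.trans (sum_bound P w W 1 hw1 (fun x _ _ => by linarith [hw1 x])))
  have hb1' : (5 / 8 : ℚ) * n < f + (n - f) * (1 / 2) := by
    have : W * ((5 / 8 : ℚ) * n) < W * (f + (n - f) * (1 / 2)) := by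
      calc W * ((5 / 8 : ℚ) * n) = 5 / 8 * (n * W) := by ring
        _ < _ := hb1
    exact lt_of_mul_lt_mul_left this hWpos.le
  have h4 : n < 4 * f := by
    have : (n : ℚ) < 4 * f := by linarith
    exact_mod_cast this
  have hkf' : n = f * k := hkf
  have hk4 : k < 4 := by
    by_contra hcon
    push Not at hcon
    have : f * 4 ≤ f * k := Nat.mul_le_mul_left _ hcon
    omega
  have hk0 : k ≠ 0 := by rintro rfl; omega
  have hkp : k ∣ p ^ (Nat.card G).factorization p := by
    rw [← P.card_eq_multiplicity]; exact ⟨f, by rw [mul_comm]; exact hkf⟩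
  have hFN : ∀ x ∈ fixP P, ∀ y ∈ Subgroup.normalizer (P : Set G), y * x = x * y := fun x hx y hy =>
    Subgroup.mem_centralizer_iff.1 hx.2 y hy
  have hPN : (P : Subgroup G) ≤ Subgroup.normalizer (P : Set G) := Subgroup.le_normalizer
  -- general prime case facts
  have hgen : k.Prime → ∀ y ∈ Subgroup.normalizer (P : Set G), ∀ a ∈ P, a ∉ fixP P →
      y * a = a * y → y ∈ Subgroup.centralizer (P : Set G) := by
    intro hkpr y hy a ha haF hya
    have hD : (P : Subgroup G) ⊓ Subgroup.centralizer ({y} : Set G) = P := by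
      refine eq_of_prime_index hkpr (by rw [mul_comm]; exact hkf) (F := fixP P)
        (le_inf hFP ?_) inf_le_left (a := a) ⟨ha, ?_⟩ haF
      · intro x hx
        rw [Subgroup.mem_centralizer_singleton_iff]
        exact (hFN x hx y hy).symm
      · exact Subgroup.mem_centralizer_singleton_iff.2 hya.symm
    rw [Subgroup.mem_centralizer_iff]
    intro x hx
    have hx' : x ∈ (P : Subgroup G) ⊓ Subgroup.centralizer ({y} : Set G) := by rw [hD]; exact hx
    exact Subgroup.mem_centralizer_singleton_iff.1 hx'.2
  have hab : k.Prime → (P : Subgroup G) ≤ Subgroup.centralizer (P : Set G) := by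
    intro hkpr y hy
    by_cases hyF : y ∈ fixP P
    · rw [Subgroup.mem_centralizer_iff]
      intro x hx
      exact hFN y hyF x (hPN hx)
    · exact hgen hkpr y (hPN hy) y hy hyF rfl
  have hk123 : k = 1 ∨ k = 2 ∨ k = 3 := by omega
  rcases hk123 with rfl | rfl | rfl
  · left
    have hFe : fixP P = P := Subgroup.eq_of_le_of_card_ge hFP (by omega)
    intro y hy
    rw [Subgroup.mem_centralizer_iff]
    intro x hx
    exact (hFN x (by rw [hFe]; exact hx) y hy).symm
  · left
    have hp2 : 2 = p := (Nat.prime_dvd_prime_iff_eq Nat.prime_two hp.out).1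
      (Nat.prime_two.dvd_of_dvd_pow hkp)
    intro y hy
    -- an element outside fixP
    have hex : ∃ a ∈ P, a ∉ fixP P := by
      by_contra hcon
      push Not at hcon
      have : (P : Subgroup G) ≤ fixP P := fun a ha => hcon a ha
      have := Nat.le_of_dvd Nat.card_pos (Subgroup.card_dvd_of_le this)
      omega
    obtain ⟨a, ha, haF⟩ := hex
    refine hgen Nat.prime_two y hy a ha haF ?_
    -- f₀ with y a y⁻¹ = a f₀
    have hyaP : y * a * y⁻¹ ∈ P := (Subgroup.mem_normalizer_iff.1 hy a).1 ha
    have hnF : y * a * y⁻¹ ∉ fixP P := by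
      intro hmem
      have h1 := hFN _ hmem y hy
      have h2 : y * a * y⁻¹ = a := by
        have : y * (y * a * y⁻¹) = y * a := by rw [h1]; group
        exact mul_left_cancel this
      rw [h2] at hmem
      exact haF hmem
    have hidx : (fixP P).relIndex P = 2 := by
      have := relIndex_mul_card' hFP
      apply Nat.eq_of_mul_eq_mul_right hfpos
      rw [this]; omega
    have hf0 : a⁻¹ * (y * a * y⁻¹) ∈ fixP P := by
      have h1 : ((fixP P).subgroupOf (P : Subgroup G)).index = 2 := hidx
      have h2 := (Subgroup.mul_mem_iff_of_index_two h1 (a := (⟨a, ha⟩ : (P : Subgroup G))⁻¹)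
        (b := ⟨y * a * y⁻¹, hyaP⟩)).2
      have h3 := h2 (by
        rw [inv_mem_iff, Subgroup.mem_subgroupOf, Subgroup.mem_subgroupOf]
        exact ⟨fun h => absurd h haF, fun h => absurd h hnF⟩)
      simpa [Subgroup.mem_subgroupOf] using h3
    set e := a⁻¹ * (y * a * y⁻¹) with he
    have hye : y * a * y⁻¹ = a * e := by simp [he]
    have hpow : ∀ m : ℕ, y ^ m * a = a * e ^ m * y ^ m := by
      intro m
      induction m with
      | zero => simp
      | succ m ih =>
        have hc : y * e ^ m = e ^ m * y := by
          have : Commute y e := hFN e hf0 y hy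
          exact (this.pow_right m).eq
        have hya : y * a = a * e * y := by rw [← hye]; group
        rw [pow_succ' y, mul_assoc, ih, ← mul_assoc, ← mul_assoc, hya, mul_assoc (a * e), hc,
          pow_succ' e]
        simp only [mul_assoc]
    -- odd index
    let C : Subgroup G := Subgroup.centralizer (P : Set G)
    let N : Subgroup G := Subgroup.normalizer (P : Set G)
    have hCN : C ≤ N := Subgroup.centralizer_le_normalizer _
    have hnorm : (C.subgroupOf N).Normal := by
      rw [Subgroup.normal_subgroupOf_iff hCN]
      intro c n hc hn
      rw [Subgroup.mem_centralizer_iff]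
      intro x hx
      have h1 : n⁻¹ * x * n ∈ (P : Set G) := by
        have := (Subgroup.mem_normalizer_iff.1 (inv_mem hn) x).1 hx
        rw [inv_inv] at this
        exact this
      have h2 := Subgroup.mem_centralizer_iff.1 hc _ h1
      have h3 : x * n * c = n * c * (n⁻¹ * x * n) := by
        rw [mul_assoc n c, ← h2]; group
      calc x * (n * c * n⁻¹) = (x * n * c) * n⁻¹ := by group
        _ = _ := by rw [h3]; group
    set m := C.relIndex N with hm
    have hmP : ¬ p ∣ m := by
      intro hd
      have h1 : m ∣ (P : Subgroup G).relIndex N := 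
        Subgroup.relIndex_dvd_of_le_left N (hab Nat.prime_two)
      have h2 : (P : Subgroup G).relIndex N ∣ (P : Subgroup G).index :=
        Subgroup.relIndex_dvd_index_of_le hPN
      exact P.not_dvd_index (hd.trans (h1.trans h2))
    have hym : y ^ m ∈ C := by
      have := Subgroup.pow_index_mem (C.subgroupOf N) ⟨y, hy⟩
      rw [Subgroup.mem_subgroupOf] at this
      exact this
    have h5 := Subgroup.mem_centralizer_iff.1 hym a ha
    rw [hpow m] at h5
    have h6 : e ^ m = 1 := by
      have := mul_right_cancel h5
      exact left_eq_mul.1 this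
    obtain ⟨j, hj⟩ := P.2 ⟨e, hFP hf0⟩
    have h7 : e ^ p ^ j = 1 := by simpa [Subtype.ext_iff] using hj
    have h8 : orderOf e = 1 := by
      have hco : Nat.Coprime m (p ^ j) :=
        Nat.Coprime.pow_right _ ((hp.out.coprime_iff_not_dvd).2 hmP).symm
      exact Nat.eq_one_of_dvd_coprimes hco (orderOf_dvd_of_pow_eq_one h6)
        (orderOf_dvd_of_pow_eq_one h7)
    have h9 := hpow 1
    rw [orderOf_eq_one_iff] at h8
    simpa [h8] using h9
  · right
    have hp3 : 3 = p := (Nat.prime_dvd_prime_iff_eq Nat.prime_three hp.out).1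
      (Nat.prime_three.dvd_of_dvd_pow hkp)
    refine ⟨hp3.symm, ?_⟩
    have hex : ∃ a ∈ P, a ∉ fixP P ∧
        pp S (Nat.card (Subgroup.centralizer ({a} : Set G))) = pp S (Nat.card G) := by
      by_contra hcon
      push Not at hcon
      have hb2 := h.trans_le (hk.trans (sum_bound P w W (1 / 2) hw1 (fun x hx hxF => by
        have h1 := hcon x hx hxF
        obtain ⟨c, hc⟩ := hdvd x
        have hc1 : c ≠ 1 := by rintro rfl; omega
        have hc0 : c ≠ 0 := by
          rintro rfl
          have := pp_pos hS (Nat.card G)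
          omega
        have hc2 : 2 ≤ c := by omega
        have h2 : pp S (Nat.card (Subgroup.centralizer ({x} : Set G))) * 2 ≤ pp S (Nat.card G) := by
          rw [hc]; exact Nat.mul_le_mul_left _ hc2
        have h3 : w x * 2 ≤ W := by
          have h4 := Nat.cast_le (α := ℚ) |>.2 h2
          rw [Nat.cast_mul] at h4
          exact h4
        linarith)))
      have hb2' : (5 / 8 : ℚ) * n < f + (n - f) * (1 / 2 / 2) := by
        have : W * ((5 / 8 : ℚ) * n) < W * (f + (n - f) * (1 / 2 / 2)) := by
          calc W * ((5 / 8 : ℚ) * n) = 5 / 8 * (n * W) := by ring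
            _ < _ := hb2
        exact lt_of_mul_lt_mul_left this hWpos.le
      have hq : (n : ℚ) = f * 3 := by exact_mod_cast hkf'
      have hfq : (0 : ℚ) < f := by exact_mod_cast hfpos
      rw [hq] at hb2'
      linarith
    obtain ⟨a, ha, haF, happ⟩ := hex
    refine ⟨a, ha, happ, ?_, ?_⟩
    · intro x hx
      rw [Subgroup.mem_centralizer_singleton_iff]
      exact (Subgroup.mem_centralizer_iff.1 (hab Nat.prime_three hx) a ha).symm
    · intro y hy hya
      rw [Subgroup.mem_centralizer_singleton_iff] at hya
      exact hgen Nat.prime_three y hy a ha haF hya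

end PiHall

namespace PiHall

/-- `G` has a normal `p`-complement with abelian quotient. -/
def HasNC (G : Type*) [Group G] (p : ℕ) : Prop :=
  ∃ K : Subgroup G, K.Normal ∧ ¬ p ∣ Nat.card K ∧ (∃ j, K.index = p ^ j) ∧
    ∀ a b : G, a * b * a⁻¹ * b⁻¹ ∈ K

lemma hasNC_of_sylow {G : Type*} [Group G] [Finite G] {p : ℕ} [hp : Fact p.Prime] (P : Sylow p G)
    (hP : Subgroup.normalizer (P : Set G) ≤ Subgroup.centralizer (P : Set G)) : HasNC G p := by
  refine ⟨(MonoidHom.transferSylow P hP).ker, inferInstance,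
    MonoidHom.not_dvd_card_ker_transferSylow P hP, ?_, ?_⟩
  · have h1 := MonoidHom.ker_transferSylow_isComplement' P hP
    exact ⟨(Nat.card G).factorization p, by
      rw [← P.card_eq_multiplicity]; exact h1.symm.index_eq_card⟩
  · intro a b
    have hcomm : ∀ x y : P, x * y = y * x := by
      rintro ⟨x, hx⟩ ⟨y, hy⟩
      have h2 := hP (Subgroup.le_normalizer (H := (P : Subgroup G)) hy)
      exact Subtype.ext (Subgroup.mem_centralizer_iff.1 h2 x hx)
    rw [MonoidHom.mem_ker]
    simp only [map_mul, map_inv]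
    rw [hcomm (MonoidHom.transferSylow P hP a)]
    group

lemma HasNC.subgroup {G : Type*} [Group G] [Finite G] {p : ℕ} (hp : p.Prime) (h : HasNC G p)
    (C : Subgroup G) : HasNC C p := by
  obtain ⟨K, hK, hcard, ⟨j, hj⟩, hcomm⟩ := h
  refine ⟨K.subgroupOf C, inferInstance, ?_, ?_, ?_⟩
  · intro hd
    exact hcard (hd.trans (Subgroup.card_comap_dvd_of_injective K C.subtype C.subtype_injective))
  · have h1 : K.relIndex C ∣ K.index := Subgroup.relIndex_dvd_index_of_normal K C
    rw [hj] at h1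
    obtain ⟨i, -, hi⟩ := (Nat.dvd_prime_pow hp).1 h1
    exact ⟨i, hi⟩
  · intro a b
    rw [Subgroup.mem_subgroupOf]
    exact hcomm a b

lemma index_eq_of {G : Type*} [Group G] [Finite G] {p : ℕ} (hp : p.Prime) {K : Subgroup G}
    (hcard : ¬ p ∣ Nat.card K) {j : ℕ} (hj : K.index = p ^ j) :
    K.index = p ^ (Nat.card G).factorization p := by
  have h1 := K.card_mul_index
  rw [hj] at h1 ⊢
  rw [← h1, Nat.factorization_mul Nat.card_pos.ne' (pow_ne_zero _ hp.ne_zero), Finsupp.add_apply,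
    Nat.factorization_eq_zero_of_not_dvd hcard, hp.factorization_pow]
  simp

lemma exists_normal {G : Type*} [Group G] [Finite G] (S : Finset ℕ) :
    (∀ p ∈ S, p.Prime) → (∀ p ∈ S, HasNC G p) →
    ∃ K : Subgroup G, K.Normal ∧ K.index = pp S (Nat.card G) ∧
      ∀ a b : G, a * b * a⁻¹ * b⁻¹ ∈ K := by
  induction S using Finset.induction_on with
  | empty =>
    intro _ _
    exact ⟨⊤, inferInstance, by simp [pp], by simp⟩
  | insert p S hpS ih =>
    intro hS hN
    have hS' : ∀ q ∈ S, q.Prime := fun q hq => hS q (by simp [hq])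
    have hp : p.Prime := hS p (by simp)
    obtain ⟨K, hK, hKi, hKc⟩ := ih hS' (fun q hq => hN q (by simp [hq]))
    obtain ⟨M, hM, hMcard, ⟨j, hj⟩, hMc⟩ := hN p (by simp)
    have hMi := index_eq_of hp hMcard hj
    refine ⟨M ⊓ K, inferInstance, ?_, fun a b => ⟨hMc a b, hKc a b⟩⟩
    rw [pp_insert hpS, ← hMi, ← hKi]
    have hco : Nat.Coprime M.index K.index := by
      rw [hMi, hKi]
      unfold pp
      refine Nat.Coprime.prod_right fun q hq => ?_
      refine Nat.Coprime.pow _ _ ((Nat.coprime_primes hp (hS' q hq)).2 ?_)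
      rintro rfl; exact hpS hq
    refine le_antisymm Subgroup.index_inf_le (Nat.le_of_dvd ?_ ?_)
    · exact Nat.pos_of_ne_zero Subgroup.index_ne_zero_of_finite
    · exact hco.mul_dvd_of_dvd_of_dvd (Subgroup.index_dvd_of_le inf_le_left)
        (Subgroup.index_dvd_of_le inf_le_right)

lemma exists_hall {G : Type*} [Group G] [Finite G] (S : Finset ℕ)
    (hS : ∀ p ∈ S, p.Prime) (hN : ∀ p ∈ S, HasNC G p) :
    ∃ H : Subgroup G, Nat.card H = pp S (Nat.card G) ∧ ∀ a ∈ H, ∀ b ∈ H, a * b = b * a := by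
  obtain ⟨K, hK, hKi, hKc⟩ := exists_normal S hS hN
  have hco : (Nat.card K).Coprime K.index := by
    refine Nat.Coprime.symm (Nat.coprime_of_dvd fun q hq hq1 hq2 => ?_)
    have h1 := congrArg (fun n => n.factorization q) K.card_mul_index
    simp only [Nat.factorization_mul (Nat.card_pos (α := K)).ne' K.index_ne_zero_of_finite,
      Finsupp.add_apply] at h1
    have h2 := hq.factorization_pos_of_dvd (Nat.card_pos (α := K)).ne' hq2
    have h3 := hq.factorization_pos_of_dvd K.index_ne_zero_of_finite hq1
    rw [hKi, factorization_pp hS] at h1 h3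
    split_ifs at h1 h3 <;> omega
  obtain ⟨H, hH⟩ := Subgroup.exists_right_complement'_of_coprime hco
  refine ⟨H, ?_, ?_⟩
  · rw [← hKi]; exact hH.symm.index_eq_card.symm
  · intro a ha b hb
    have h1 : a * b * a⁻¹ * b⁻¹ ∈ K ⊓ H :=
      ⟨hKc a b, H.mul_mem (H.mul_mem (H.mul_mem ha hb) (H.inv_mem ha)) (H.inv_mem hb)⟩
    rw [hH.disjoint.eq_bot, Subgroup.mem_bot] at h1
    have h2 := mul_inv_eq_one.1 h1
    exact (mul_inv_eq_iff_eq_mul.1 h2)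

lemma fixed_conj {G : Type*} [Group G] [Finite G] {q : ℕ} [Fact q.Prime] {C H T : Subgroup G}
    (hHC : H ≤ C) (hTC : T ≤ C) (hT : IsPGroup q T) (hq : ¬ q ∣ H.index) :
    ∃ c ∈ C, ∀ t ∈ T, c⁻¹ * t * c ∈ H := by
  have hT' : IsPGroup q (T.subgroupOf C) :=
    hT.of_equiv (Subgroup.subgroupOfEquivOfLe hTC).symm
  have hcard : ¬ q ∣ Nat.card (C ⧸ H.subgroupOf C) := fun hd =>
    hq (hd.trans (Subgroup.relIndex_dvd_index_of_le hHC))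
  obtain ⟨x, hx⟩ := hT'.nonempty_fixed_point_of_prime_not_dvd_card _ hcard
  obtain ⟨⟨c, hc⟩, rfl⟩ := QuotientGroup.mk_surjective x
  refine ⟨c, hc, fun t ht => ?_⟩
  have h1 := hx ⟨⟨t, hTC ht⟩, ht⟩
  have h2 : ((⟨t, hTC ht⟩ * ⟨c, hc⟩ : C) : C ⧸ H.subgroupOf C) = ((⟨c, hc⟩ : C) : C ⧸ _) := h1
  have h3 := (QuotientGroup.eq.1 h2.symm)
  rw [Subgroup.mem_subgroupOf] at h3
  simpa [mul_assoc] using h3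

lemma conj_hall {G : Type*} [Group G] (H : Subgroup G) (c : G)
    (hab : ∀ a ∈ H, ∀ b ∈ H, a * b = b * a) :
    ∃ H' : Subgroup G, Nat.card H' = Nat.card H ∧ (∀ a ∈ H', ∀ b ∈ H', a * b = b * a) ∧
      ∀ x, c⁻¹ * x * c ∈ H → x ∈ H' := by
  refine ⟨H.map (MulAut.conj c).toMonoidHom, ?_, ?_, ?_⟩
  · exact Nat.card_congr (H.equivMapOfInjective _ (MulAut.conj c).injective).symm.toEquiv
  · rintro _ ⟨a, ha, rfl⟩ _ ⟨b, hb, rfl⟩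
    rw [← map_mul, hab a ha b hb, map_mul]
  · intro x hx
    exact ⟨_, hx, by simp [mul_assoc]⟩

lemma contained {G : Type*} [Group G] [Finite G] (S : Finset ℕ) (hS : ∀ p ∈ S, p.Prime)
    (hN : ∀ p ∈ S, p ≠ 3 → HasNC G p)
    (hH : ∃ H : Subgroup G, Nat.card H = pp S (Nat.card G) ∧ ∀ a ∈ H, ∀ b ∈ H, a * b = b * a) :
    ∀ (n : ℕ) (L : Subgroup G), Nat.card L = n → (∀ q : ℕ, q.Prime → q ∣ Nat.card L → q ∈ S) →
    ∃ H : Subgroup G, Nat.card H = pp S (Nat.card G) ∧ (∀ a ∈ H, ∀ b ∈ H, a * b = b * a) ∧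
      L ≤ H := by
  intro n
  induction n using Nat.strong_induction_on with
  | _ n ih =>
  intro L hLn hL
  by_cases hq : ∃ q : ℕ, q.Prime ∧ q ∣ Nat.card L ∧ q ≠ 3
  · obtain ⟨q, hq, hqL, hq3⟩ := hq
    have hqS := hL q hq hqL
    have : Fact q.Prime := ⟨hq⟩
    obtain ⟨K, hK, hKcard, ⟨j, hj⟩, -⟩ := hN q hqS hq3
    let M : Subgroup G := L ⊓ K
    have hML : M ≤ L := inf_le_left
    have hMq : ¬ q ∣ Nat.card M := fun hd =>
      hKcard (hd.trans (Subgroup.card_dvd_of_le inf_le_right))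
    have hMlt : Nat.card M < n := by
      rw [← hLn]
      refine lt_of_le_of_ne (Nat.le_of_dvd Nat.card_pos (Subgroup.card_dvd_of_le hML)) fun he => hMq (he ▸ hqL)
    obtain ⟨H, hHc, hHab, hMH⟩ := ih _ hMlt M rfl
      (fun r hr hrd => hL r hr (hrd.trans (Subgroup.card_dvd_of_le hML)))
    let C : Subgroup G := Subgroup.centralizer (M : Set G)
    let N : Subgroup G := Subgroup.normalizer (M : Set G)
    have hHC : H ≤ C := fun a ha => Subgroup.mem_centralizer_iff.2 fun b hb =>
      hHab b (hMH hb) a ha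
    have hCN : C ≤ N := Subgroup.centralizer_le_normalizer _
    have hMn : (M.subgroupOf L).Normal := by
      rw [Subgroup.normal_subgroupOf_iff hML]
      intro m l hm hl
      exact ⟨L.mul_mem (L.mul_mem hl hm.1) (L.inv_mem hl), hK.conj_mem m hm.2 l⟩
    have hLN : L ≤ N := (Subgroup.normal_subgroupOf_iff_le_normalizer hML).1 hMn
    have hLC : L ≤ C := by
      intro l hl
      have h1 : l ^ (C.relIndex N) ∈ C := by
        have := Subgroup.pow_index_mem (C.subgroupOf N) ⟨l, hLN hl⟩
        rw [Subgroup.mem_subgroupOf] at this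
        exact this
      have h2 : C.relIndex N ∣ H.index :=
        (Subgroup.relIndex_dvd_index_of_le hCN).trans (Subgroup.index_dvd_of_le hHC)
      have h3 : orderOf l ∣ Nat.card L := Subgroup.orderOf_dvd_natCard L hl
      have hco : (C.relIndex N).Coprime (orderOf l) := by
        refine Nat.coprime_of_dvd fun r hr hr1 hr2 => ?_
        exact not_dvd_index hS H hHc (hL r hr (hr2.trans h3)) (hr1.trans h2)
      obtain ⟨m, hm⟩ := exists_pow_eq_self_of_coprime hco
      rw [← hm]
      exact C.pow_mem h1 m
    -- Sylow subgroup of L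
    have hrel : M.relIndex L ∣ q ^ j := by
      have h1 : M.relIndex L = K.relIndex L := Subgroup.inf_relIndex_left L K
      rw [h1, ← hj]
      exact Subgroup.relIndex_dvd_index_of_normal K L
    obtain ⟨i, -, hi⟩ := (Nat.dvd_prime_pow hq).1 hrel
    have hcardL : q ^ i * Nat.card M = Nat.card L := by
      rw [← hi]; exact relIndex_mul_card' hML
    obtain ⟨T0, hT0⟩ := Sylow.exists_subgroup_card_pow_prime (G := L) q (n := i) ⟨_, hcardL.symm⟩
    let T : Subgroup G := T0.map L.subtype
    have hTc : Nat.card T = q ^ i := by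
      rw [← hT0]
      exact Nat.card_congr (T0.equivMapOfInjective _ L.subtype_injective).symm.toEquiv
    have hTL : T ≤ L := Subgroup.map_subtype_le T0
    have hsup : M ⊔ T = L := by
      refine Subgroup.eq_of_le_of_card_ge (sup_le hML hTL) ?_
      rw [← hcardL]
      refine Nat.le_of_dvd Nat.card_pos ?_
      refine Nat.Coprime.mul_dvd_of_dvd_of_dvd ?_ ?_ ?_
      · exact Nat.Coprime.pow_left _ ((hq.coprime_iff_not_dvd).2 hMq)
      · rw [← hTc]; exact Subgroup.card_dvd_of_le le_sup_right
      · exact Subgroup.card_dvd_of_le le_sup_left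
    obtain ⟨c, hc, hcT⟩ := fixed_conj (q := q) hHC (hTL.trans hLC) (IsPGroup.of_card hTc)
      (not_dvd_index hS H hHc hqS)
    obtain ⟨H', hH'c, hH'ab, hH'⟩ := conj_hall H c hHab
    refine ⟨H', hH'c.trans hHc, hH'ab, ?_⟩
    rw [← hsup]
    refine sup_le (fun m hm => hH' m ?_) (fun t ht => hH' t (hcT t ht))
    have h1 := Subgroup.mem_centralizer_iff.1 hc m hm
    rw [mul_assoc, h1, inv_mul_cancel_left]
    exact hMH hm
  · push Not at hq
    obtain ⟨H, hHc, hHab⟩ := hH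
    have h3 : Fact (Nat.Prime 3) := ⟨Nat.prime_three⟩
    by_cases h1 : Nat.card L = 1
    · rw [Subgroup.card_eq_one.1 h1]
      exact ⟨H, hHc, hHab, bot_le⟩
    · have h3L : 3 ∣ Nat.card L := by
        obtain ⟨q, hq1, hq2⟩ := Nat.exists_prime_and_dvd h1
        rw [← hq q hq1 hq2]; exact hq2
      have hc := Nat.eq_prime_pow_of_unique_prime_dvd (Nat.card_pos (α := L)).ne'
        (p := 3) (fun {d} hd hdd => hq d hd hdd)
      obtain ⟨c, -, hcT⟩ := fixed_conj (q := 3) (le_top : H ≤ ⊤) (le_top : L ≤ ⊤)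
        (IsPGroup.of_card hc) (not_dvd_index hS H hHc (hL 3 Nat.prime_three h3L))
      obtain ⟨H', hH'c, hH'ab, hH'⟩ := conj_hall H c hHab
      exact ⟨H', hH'c.trans hHc, hH'ab, fun t ht => hH' t (hcT t ht)⟩

lemma exists_hall_of {G : Type*} [Group G] [Finite G] (S : Finset ℕ) (hS : ∀ p ∈ S, p.Prime)
    (h : (5 / 8 : ℚ) * pp S (Nat.card G) < kPi (↑S) G) :
    (∀ p ∈ S, p ≠ 3 → HasNC G p) ∧ ∃ H : Subgroup G, Nat.card H = pp S (Nat.card G) ∧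
      ∀ a ∈ H, ∀ b ∈ H, a * b = b * a := by
  have hd := fun (p : ℕ) (hp : p ∈ S) => by
    have : Fact p.Prime := ⟨hS p hp⟩
    exact dich (S := S.erase p) (p := p) (by simp) (fun q hq => hS q (Finset.mem_of_mem_erase hq))
      (default : Sylow p G) (by rw [Finset.insert_erase hp]; exact h)
  have hgood : ∀ p ∈ S, p ≠ 3 → HasNC G p := by
    intro p hp hp3
    have : Fact p.Prime := ⟨hS p hp⟩
    rcases hd p hp with h1 | h1
    · exact hasNC_of_sylow _ h1
    · exact absurd h1.1 hp3
  refine ⟨hgood, ?_⟩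
  have h3 : Fact (Nat.Prime 3) := ⟨Nat.prime_three⟩
  by_cases h3S : 3 ∈ S
  · rcases hd 3 h3S with h1 | ⟨-, a, ha, hpp, hPC, hcen⟩
    · refine exists_hall S hS fun p hp => ?_
      by_cases hp3 : p = 3
      · subst hp3; exact hasNC_of_sylow _ h1
      · exact hgood p hp hp3
    · set P : Sylow 3 G := default
      let C : Subgroup G := Subgroup.centralizer ({a} : Set G)
      let Q : Sylow 3 C := P.subtype hPC
      have hQmem : ∀ x : C, x ∈ Q ↔ (x : G) ∈ P := fun x => Iff.rfl
      have hQ : Subgroup.normalizer (Q : Set C) ≤ Subgroup.centralizer (Q : Set C) := by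
        intro y hy
        have hyN : (y : G) ∈ Subgroup.normalizer (P : Set G) := by
          refine Subgroup.mem_normalizer_iff.2 fun x => ?_
          have key := Subgroup.mem_normalizer_iff.1 hy
          constructor
          · intro hx
            exact (key ⟨x, hPC hx⟩).1 hx
          · intro hx
            have hxC : x ∈ C := by
              have h1 : (y : G) * x * (y : G)⁻¹ ∈ C := hPC hx
              have h2 := C.mul_mem (C.mul_mem (C.inv_mem y.2) h1) y.2
              simpa [mul_assoc] using h2
            exact (key ⟨x, hxC⟩).2 hx
        have h1 := Subgroup.mem_centralizer_iff.1 (hcen y hyN y.2)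
        rw [Subgroup.mem_centralizer_iff]
        intro x hx
        exact Subtype.ext (h1 x hx)
      have hNC : ∀ p ∈ S, HasNC C p := by
        intro p hp
        by_cases hp3 : p = 3
        · subst hp3; exact hasNC_of_sylow Q hQ
        · exact (hgood p hp hp3).subgroup (hS p hp) C
      obtain ⟨H, hHc, hHab⟩ := exists_hall S hS hNC
      have hCG : pp S (Nat.card C) = pp S (Nat.card G) := by
        rw [← Finset.insert_erase h3S, pp_insert (by simp), pp_insert (by simp), hpp,
          ← P.card_eq_multiplicity, ← Q.card_eq_multiplicity]
        congr 1
        exact Nat.card_congr (Subgroup.subgroupOfEquivOfLe hPC).toEquiv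
      refine ⟨H.map C.subtype, ?_, ?_⟩
      · rw [← hCG, ← hHc]
        exact Nat.card_congr (H.equivMapOfInjective _ C.subtype_injective).symm.toEquiv
      · rintro _ ⟨a, ha, rfl⟩ _ ⟨b, hb, rfl⟩
        rw [← map_mul, hHab a ha b hb, map_mul]
  · refine exists_hall S hS fun p hp => hgood p hp ?_
    rintro rfl; exact h3S hp

lemma kPi_congr {G : Type*} [Group G] [Finite G] (π : Set ℕ) :
    kPi π G = kPi (↑((Nat.card G).primeFactors.filter (· ∈ π))) G := by
  have h : ∀ x : G, IsPiElement π x ↔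
      IsPiElement (↑((Nat.card G).primeFactors.filter (· ∈ π))) x := by
    intro x
    refine forall_congr' fun q => forall_congr' fun hq => forall_congr' fun hd => ?_
    simp only [Finset.coe_filter, Set.mem_ofPred_eq, Nat.mem_primeFactors]
    exact ⟨fun h => ⟨⟨hq, hd.trans (orderOf_dvd_natCard x), Nat.card_pos.ne'⟩, h⟩, fun h => h.2⟩
  unfold kPi
  simp_rw [h]

end PiHall

/-- If `d_π(G) > 5/8` then every `π`-subgroup of `G` lies in some Hall
`π`-subgroup of `G`. -/
theorem pi_subgroup_le_hall_of_five_eighths_lt_dPi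
    {G : Type*} [Group G] [Finite G] (π : Set ℕ)
    (hπ : ∀ p ∈ π, Nat.Prime p) (h : 5 / 8 < dPi π G) :
    ∀ L : Subgroup G, (∀ q : ℕ, q.Prime → q ∣ Nat.card L → q ∈ π) →
      ∃ H : Subgroup G, Nat.card H = piPart π (Nat.card G) ∧ L ≤ H := by
  intro L hL
  unfold dPi at h
  rw [PiHall.kPi_congr, PiHall.piPart_eq_pp] at h
  rw [PiHall.piPart_eq_pp]
  set S := (Nat.card G).primeFactors.filter (· ∈ π) with hSdef
  have hS : ∀ p ∈ S, p.Prime := fun p hp => Nat.prime_of_mem_primeFactors (Finset.mem_filter.1 hp).1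
  have hpos : (0 : ℚ) < PiHall.pp S (Nat.card G) := Nat.cast_pos.2 (PiHall.pp_pos hS _)
  rw [lt_div_iff₀ hpos] at h
  obtain ⟨h1, h2⟩ := PiHall.exists_hall_of S hS h
  obtain ⟨H, hH, -, hLH⟩ := PiHall.contained S hS h1 h2 _ L rfl (fun q hq hqd => by
    rw [hSdef, Finset.mem_filter, Nat.mem_primeFactors]
    exact ⟨⟨hq, hqd.trans (Subgroup.card_subgroup_dvd_card L), Nat.card_pos.ne'⟩, hL q hq hqd⟩)
  exact ⟨H, hH, hLH⟩
end
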